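/- arXiv:1709.04024 — 7 statements merged into one kernel-verified Lean document; each statement's English description precedes it below -/
import Mathlib

section
/- Let (X,Y) be a pair of real-valued random variables and let X_r be a Borel subset of ℝ with α := P(X ∈ X_r) ∈ (0,1), such that: (i) X and Y are independent conditioned on the event {X ∉ X_r}, and (ii) the conditional law of Y given {X ∈ X_r} equals the conditional law of Y given {X ∉ X_r}. Then the hypercontractivity coefficient from Y to X satisfies s(Y;X) = α · s(Y; X_r), where s(Y; X_r) is the hypercontractivity coefficient of the pair (Y, X) computed under the conditional probability measure P(· | X ∈ X_r). -/
open MeasureTheory ProbabilityTheory Real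

/-- Kullback–Leibler divergence between two measures, valued in the extended reals. -/
noncomputable def klDivE {α : Type*} [MeasurableSpace α] (μ ν : Measure α) : EReal :=
  open Classical in
  if μ ≪ ν ∧ Integrable (llr μ ν) μ then ((∫ x, llr μ ν x ∂μ : ℝ) : EReal) else ⊤

/-- Mutual information `I(U;X) = D(law(U,X) ‖ law U ⊗ law X)`. -/
noncomputable def mutInfoE {Ω α β : Type*} [MeasurableSpace Ω] [MeasurableSpace α]
    [MeasurableSpace β] (U : Ω → α) (X : Ω → β) (P : Measure Ω) : EReal :=
  klDivE (P.map (fun ω => (U ω, X ω))) ((P.map U).prod (P.map X))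

/-- A witness for the supremum defining the hypercontractivity coefficient of a joint law `μ`
on `ℝ × ℝ`: a random variable `U` with values in an arbitrary measurable space, defined on a
(possibly enlarged) probability space carrying random variables `X`, `Y` whose joint law is `μ`,
such that `U — X — Y` is a Markov chain (i.e. `U` and `Y` are conditionally independent
given `X`). -/
structure MarkovWitness (μ : Measure (ℝ × ℝ)) where
  (Ω : Type)
  [mΩ : MeasurableSpace Ω]
  [sb : StandardBorelSpace Ω]
  (P : Measure Ω)
  [probP : IsProbabilityMeasure P]
  (A : Type)
  [mA : MeasurableSpace A]
  (U : Ω → A)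
  (X : Ω → ℝ)
  (Y : Ω → ℝ)
  (measU : Measurable U)
  (measX : Measurable X)
  (measY : Measurable Y)
  (law_eq : P.map (fun ω => (X ω, Y ω)) = μ)
  (markov : CondIndepFun (MeasurableSpace.comap X inferInstance) measX.comap_le U Y P)

attribute [instance] MarkovWitness.mΩ MarkovWitness.sb MarkovWitness.probP MarkovWitness.mA

/-- The hypercontractivity coefficient `s(X;Y) = sup I(U;Y)/I(U;X)`, the supremum over all `U`
(on a possibly enlarged probability space) such that `U — X — Y` is a Markov chain and
`0 < I(U;X) < ∞`. -/
noncomputable def hc {Ω : Type*} [MeasurableSpace Ω] (P : Measure Ω) (X Y : Ω → ℝ) : ℝ :=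
  sSup { t | ∃ w : MarkovWitness (P.map (fun ω => (X ω, Y ω))),
    0 < mutInfoE w.U w.X w.P ∧ mutInfoE w.U w.X w.P < ⊤ ∧
    t = (mutInfoE w.U w.Y w.P).toReal / (mutInfoE w.U w.X w.P).toReal }

lemma klDivE_split {E : Type*} [MeasurableSpace E] (L M ρ N : Measure E)
    [IsFiniteMeasure L] [IsFiniteMeasure M] [IsFiniteMeasure ρ] [IsFiniteMeasure N]
    (S : Set E) (hS : MeasurableSet S) (c : ENNReal) (hc : c ≠ 0) (hc' : c ≠ ⊤)
    (h1 : L.restrict S = c • ρ) (h2 : M.restrict S = c • N)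
    (h3 : L.restrict Sᶜ = M.restrict Sᶜ) :
    (klDivE L M).toReal = c.toReal * (klDivE ρ N).toReal := by
  have hac : L ≪ M ↔ ρ ≪ N := by
    constructor
    · intro h
      have h' := h.restrict S
      rw [h1, h2] at h'
      exact (Measure.absolutelyContinuous_smul hc).trans
        (h'.trans Measure.smul_absolutelyContinuous)
    · intro h
      rw [← Measure.restrict_add_restrict_compl (μ := L) hS,
        ← Measure.restrict_add_restrict_compl (μ := M) hS, h1, h2, h3]
      exact Measure.AbsolutelyContinuous.add
        ((Measure.smul_absolutelyContinuous.trans h).trans (Measure.absolutelyContinuous_smul hc))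
        Measure.AbsolutelyContinuous.rfl
  by_cases hρ : ρ ≪ N
  swap
  · have hL : ¬ L ≪ M := fun h => hρ (hac.1 h)
    simp [klDivE, hρ, hL]
  have hL := hac.2 hρ
  have hLd : L = M.withDensity (fun x => S.indicator (ρ.rnDeriv N) x + Sᶜ.indicator 1 x) := by
    have hm : Measurable (S.indicator (ρ.rnDeriv N)) :=
      (Measure.measurable_rnDeriv _ _).indicator hS
    have : (fun x => S.indicator (ρ.rnDeriv N) x + Sᶜ.indicator 1 x)
      = S.indicator (ρ.rnDeriv N) + Sᶜ.indicator 1 := rfl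
    rw [this, withDensity_add_left hm, withDensity_indicator hS, withDensity_indicator hS.compl,
      h2, withDensity_smul_measure, Measure.withDensity_rnDeriv_eq _ _ hρ, withDensity_one,
      ← h1, ← h3, Measure.restrict_add_restrict_compl hS]
  have hrn : L.rnDeriv M =ᵐ[M] (fun x => S.indicator (ρ.rnDeriv N) x + Sᶜ.indicator 1 x) := by
    conv_lhs => rw [hLd]
    exact Measure.rnDeriv_withDensity _ (((Measure.measurable_rnDeriv _ _).indicator hS).add
      (measurable_one.indicator hS.compl))
  have hrn' := hL.ae_le hrn
  have e1 : llr L M =ᵐ[L.restrict S] llr ρ N := by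
    filter_upwards [ae_restrict_of_ae hrn', ae_restrict_mem hS] with x hx hxS
    simp [llr, hx, hxS]
  have e2 : llr L M =ᵐ[L.restrict Sᶜ] 0 := by
    filter_upwards [ae_restrict_of_ae hrn', ae_restrict_mem hS.compl] with x hx hxS
    have : x ∉ S := hxS
    simp [llr, hx, this]
  have i2 : IntegrableOn (llr L M) Sᶜ L := (integrable_congr e2).2 (integrable_zero _ _ _)
  have i1 : IntegrableOn (llr L M) S L ↔ Integrable (llr ρ N) ρ := by
    unfold IntegrableOn
    rw [integrable_congr e1, h1, integrable_smul_measure hc hc']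
  have hi : Integrable (llr L M) L ↔ Integrable (llr ρ N) ρ := by
    rw [← i1, ← integrableOn_univ, ← Set.union_compl_self S, integrableOn_union]
    exact ⟨fun h => h.1, fun h => ⟨h, i2⟩⟩
  by_cases hI : Integrable (llr ρ N) ρ
  swap
  · have hL : ¬ Integrable (llr L M) L := fun h => hI (hi.1 h)
    simp [klDivE, hI, hL]
  have hI' := hi.2 hI
  simp only [klDivE, hL, hρ, hI, hI', and_self, if_true, EReal.toReal_coe]
  rw [← integral_add_compl hS hI', integral_congr_ae e1, integral_congr_ae e2, h1,
    integral_smul_measure]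
  simp

lemma setIntegral_ind {Ω : Type*} [MeasurableSpace Ω] (P : Measure Ω)
    {s t : Set Ω} (hs : MeasurableSet s) :
    ∫ x in t, s.indicator (fun _ => (1 : ℝ)) x ∂P = P.real (s ∩ t) := by
  rw [integral_indicator hs, integral_const, smul_eq_mul, mul_one,
    measureReal_restrict_apply MeasurableSet.univ, Set.univ_inter]
  rw [measureReal_restrict_apply hs]

lemma condExp_char {Ω : Type*} {m m₀ : MeasurableSpace Ω} (hm : m ≤ m₀)
    (P : Measure Ω) [IsFiniteMeasure P] (s : Set Ω) (hs : MeasurableSet[m₀] s) (g : Ω → ℝ)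
    (hg : StronglyMeasurable[m] g) (hgi : Integrable g P)
    (h : ∀ t, MeasurableSet[m] t → ∫ x in t, g x ∂P = P.real (s ∩ t)) :
    g =ᵐ[P] P⟦s | m⟧ := by
  refine ae_eq_condExp_of_forall_setIntegral_eq hm ?_ (fun s _ _ => hgi.integrableOn) ?_
    hg.aestronglyMeasurable
  · exact (integrable_const _).indicator hs
  · intro t ht _
    rw [h t ht, setIntegral_ind P hs]

lemma setIntegral_condProb {Ω : Type*} {m m₀ : MeasurableSpace Ω} (hm : m ≤ m₀)
    (P : Measure Ω) [IsFiniteMeasure P] (s t : Set Ω) (hs : MeasurableSet[m₀] s)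
    (ht : MeasurableSet[m] t) : ∫ x in t, (P⟦s | m⟧) x ∂P = P.real (s ∩ t) := by
  rw [setIntegral_condExp hm ((integrable_const _).indicator hs) ht, setIntegral_ind P hs]

/-- If `X ∈ c` is independent of `Y`, the conditional probability is constant. -/
lemma condProb_const {Ω : Type*} {m₀ : MeasurableSpace Ω} (P : Measure Ω)
    [IsProbabilityMeasure P] (Y : Ω → ℝ) (hY : Measurable Y) (s : Set Ω) (hs : MeasurableSet s)
    (h : ∀ b, MeasurableSet b → P.real (s ∩ Y ⁻¹' b) = P.real (Y ⁻¹' b) * P.real s) :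
    (fun _ => P.real s) =ᵐ[P] P⟦s | MeasurableSpace.comap Y inferInstance⟧ := by
  refine condExp_char hY.comap_le P s hs _ stronglyMeasurable_const (integrable_const _) ?_
  rintro t ⟨b, hb, rfl⟩
  rw [h b hb]
  simp

lemma markov_prod {Ω A : Type*} {m₀ : MeasurableSpace Ω} [StandardBorelSpace Ω]
    [MeasurableSpace A] (P : Measure Ω) [IsProbabilityMeasure P] (U : Ω → A) (Y X : Ω → ℝ)
    (hU : Measurable U) (hY : Measurable Y) (hX : Measurable X)
    (hM : CondIndepFun (MeasurableSpace.comap Y inferInstance) hY.comap_le U X P)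
    (c : Set ℝ) (hc : MeasurableSet c)
    (h : ∀ b, MeasurableSet b →
      P.real (X ⁻¹' c ∩ Y ⁻¹' b) = P.real (Y ⁻¹' b) * P.real (X ⁻¹' c))
    (a : Set A) (ha : MeasurableSet a) (b : Set ℝ) (hb : MeasurableSet b) :
    P.real (U ⁻¹' a ∩ X ⁻¹' c ∩ Y ⁻¹' b) = P.real (U ⁻¹' a ∩ Y ⁻¹' b) * P.real (X ⁻¹' c) := by
  have h1 := condProb_const P Y hY (X ⁻¹' c) (hX hc) h
  have h2 := (condIndepFun_iff_condExp_inter_preimage_eq_mul hU hX).1 hM a c ha hc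
  have hbm : MeasurableSet[MeasurableSpace.comap Y inferInstance] (Y ⁻¹' b) := ⟨b, hb, rfl⟩
  rw [← setIntegral_condProb hY.comap_le P _ _ ((hU ha).inter (hX hc)) hbm,
    ← setIntegral_condProb hY.comap_le P _ _ (hU ha) hbm, ← integral_mul_const]
  refine integral_congr_ae (ae_restrict_of_ae ?_)
  filter_upwards [h1, h2] with x hx1 hx2
  rw [hx2, ← hx1]

lemma cond_real_apply' {Ω : Type*} [MeasurableSpace Ω] (P : Measure Ω) {s : Set Ω}
    (hs : MeasurableSet s) (t : Set Ω) :
    (ProbabilityTheory.cond P s).real t = (P.real s)⁻¹ * P.real (s ∩ t) := by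
  simp [Measure.real, cond_apply hs, ENNReal.toReal_mul]

section dir1

variable {Ω A : Type*} {m₀ : MeasurableSpace Ω} [StandardBorelSpace Ω]
    [MeasurableSpace A] (P : Measure Ω) [IsProbabilityMeasure P] (U : Ω → A) (Y X : Ω → ℝ)
    (hU : Measurable U) (hY : Measurable Y) (hX : Measurable X)
    (hM : CondIndepFun (MeasurableSpace.comap Y inferInstance) hY.comap_le U X P)
    (Xr : Set ℝ) (hXr : MeasurableSet Xr) (h0 : P (X ⁻¹' Xr) ≠ 0)
    (F1 : ∀ b, MeasurableSet b →
      P.real (X ⁻¹' Xr ∩ Y ⁻¹' b) = P.real (Y ⁻¹' b) * P.real (X ⁻¹' Xr))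
    (F2 : ∀ c, MeasurableSet c → ∀ b, MeasurableSet b →
      P.real (X ⁻¹' (c ∩ Xrᶜ) ∩ Y ⁻¹' b) = P.real (Y ⁻¹' b) * P.real (X ⁻¹' (c ∩ Xrᶜ)))

lemma smul_cond_eq {Ω : Type*} {m₀ : MeasurableSpace Ω} (P : Measure Ω) [IsFiniteMeasure P]
    (K : Set Ω) (h0 : P K ≠ 0) : P K • ProbabilityTheory.cond P K = P.restrict K := by
  rw [ProbabilityTheory.cond, smul_smul, ENNReal.mul_inv_cancel h0 (measure_ne_top _ _), one_smul]

include hU hY hX hM hXr h0 F1 in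
lemma cond_map_UY : (ProbabilityTheory.cond P (X ⁻¹' Xr)).map (fun ω => (U ω, Y ω))
    = P.map (fun ω => (U ω, Y ω)) := by
  have := cond_isProbabilityMeasure h0
  refine Measure.ext_prod ?_
  intro a b ha hb
  rw [Measure.map_apply (by fun_prop) (ha.prod hb), Measure.map_apply (by fun_prop) (ha.prod hb),
    Set.mk_preimage_prod, cond_apply (hX hXr)]
  have h := markov_prod P U Y X hU hY hX hM Xr hXr F1 a ha b hb
  have h' : P (X ⁻¹' Xr ∩ (U ⁻¹' a ∩ Y ⁻¹' b)) = P (U ⁻¹' a ∩ Y ⁻¹' b) * P (X ⁻¹' Xr) := by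
    rw [← ENNReal.toReal_eq_toReal_iff' (by finiteness) (by finiteness), ENNReal.toReal_mul]
    rw [← Set.inter_assoc, Set.inter_comm (X ⁻¹' Xr)]
    exact h
  rw [h', mul_comm, mul_assoc, ENNReal.mul_inv_cancel h0 (measure_ne_top _ _), mul_one]

include hU hY hX hM hXr h0 F1 in
lemma cond_map_U : (ProbabilityTheory.cond P (X ⁻¹' Xr)).map U = P.map U := by
  have h := congrArg (Measure.map Prod.fst) (cond_map_UY P U Y X hU hY hX hM Xr hXr h0 F1)
  rwa [Measure.map_map (by fun_prop) (by fun_prop),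
    Measure.map_map (by fun_prop) (by fun_prop)] at h

include hU hY hX hM hXr h0 F1 in
lemma cond_map_Y : (ProbabilityTheory.cond P (X ⁻¹' Xr)).map Y = P.map Y := by
  have h := congrArg (Measure.map Prod.snd) (cond_map_UY P U Y X hU hY hX hM Xr hXr h0 F1)
  rwa [Measure.map_map (by fun_prop) (by fun_prop),
    Measure.map_map (by fun_prop) (by fun_prop)] at h

include hU hY hX hM hXr h0 F1 in
lemma cond_mutInfo_UY : mutInfoE U Y (ProbabilityTheory.cond P (X ⁻¹' Xr)) = mutInfoE U Y P := by
  rw [mutInfoE, mutInfoE, cond_map_UY P U Y X hU hY hX hM Xr hXr h0 F1,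
    cond_map_U P U Y X hU hY hX hM Xr hXr h0 F1, cond_map_Y P U Y X hU hY hX hM Xr hXr h0 F1]

include hU hY hX hM hXr h0 F1 F2 in
lemma cond_mutInfo_UX : (mutInfoE U X P).toReal
    = (P (X ⁻¹' Xr)).toReal * (mutInfoE U X (ProbabilityTheory.cond P (X ⁻¹' Xr))).toReal := by
  have := cond_isProbabilityMeasure h0
  have hsm := smul_cond_eq P (X ⁻¹' Xr) h0
  have hUp : IsProbabilityMeasure (P.map U) := Measure.isProbabilityMeasure_map hU.aemeasurable
  refine klDivE_split _ _ _ _ (Set.univ ×ˢ Xr) (MeasurableSet.univ.prod hXr) _ h0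
    (measure_ne_top _ _) ?_ ?_ ?_
  · rw [Measure.restrict_map (by fun_prop) (MeasurableSet.univ.prod hXr), ← Measure.map_smul,
      hsm, Set.mk_preimage_prod, Set.preimage_univ, Set.univ_inter]
  · rw [cond_map_U P U Y X hU hY hX hM Xr hXr h0 F1, ← Measure.prod_smul_right,
      ← Measure.map_smul, hsm, ← Measure.restrict_map hX hXr, ← Measure.prod_restrict,
      Measure.restrict_univ]
  · have hS : (Set.univ ×ˢ Xr : Set (A × ℝ))ᶜ = Set.univ ×ˢ Xrᶜ := by ext; simp
    rw [hS, ← Measure.prod_restrict, Measure.restrict_univ]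
    refine Measure.ext_prod ?_
    intro a c ha hc
    rw [Measure.restrict_apply (ha.prod hc), Measure.prod_prod, Measure.restrict_apply hc,
      Set.prod_inter_prod, Set.inter_univ, Measure.map_apply (by fun_prop) (ha.prod (hc.inter hXr.compl)),
      Measure.map_apply hU ha, Measure.map_apply hX (hc.inter hXr.compl), Set.mk_preimage_prod]
    have h := markov_prod P U Y X hU hY hX hM (c ∩ Xrᶜ) (hc.inter hXr.compl) (F2 c hc) a ha
      Set.univ MeasurableSet.univ
    simp only [Set.preimage_univ, Set.inter_univ] at h
    rw [← ENNReal.toReal_eq_toReal_iff' (by finiteness) (by finiteness), ENNReal.toReal_mul]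
    exact h

include hY hX hXr h0 F1 in
lemma cond_trim : (ProbabilityTheory.cond P (X ⁻¹' Xr)).trim hY.comap_le = P.trim hY.comap_le := by
  refine @Measure.ext _ (MeasurableSpace.comap Y inferInstance) _ _ ?_
  intro s hs
  rw [trim_measurableSet_eq _ hs, trim_measurableSet_eq _ hs]
  obtain ⟨b, hb, rfl⟩ := hs
  rw [cond_apply (hX hXr)]
  have h' : P (X ⁻¹' Xr ∩ Y ⁻¹' b) = P (Y ⁻¹' b) * P (X ⁻¹' Xr) := by
    rw [← ENNReal.toReal_eq_toReal_iff' (by finiteness) (by finiteness), ENNReal.toReal_mul]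
    exact F1 b hb
  rw [h', mul_comm, mul_assoc, ENNReal.mul_inv_cancel h0 (measure_ne_top _ _), mul_one]

include hY hX hXr h0 F1 in
lemma cond_condProb (s : Set Ω) (hs : MeasurableSet s) :
    (fun ω => (P.real (X ⁻¹' Xr))⁻¹ *
      (P⟦s ∩ X ⁻¹' Xr | MeasurableSpace.comap Y inferInstance⟧) ω)
    =ᵐ[ProbabilityTheory.cond P (X ⁻¹' Xr)]
    (ProbabilityTheory.cond P (X ⁻¹' Xr))⟦s | MeasurableSpace.comap Y inferInstance⟧ := by
  have := cond_isProbabilityMeasure h0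
  have ht := cond_trim P Y X hY hX Xr hXr h0 F1
  have hsm := stronglyMeasurable_condExp (m := MeasurableSpace.comap Y inferInstance)
    (f := (s ∩ X ⁻¹' Xr).indicator (fun _ => (1 : ℝ))) (μ := P)
  have hint := integrable_condExp (m := MeasurableSpace.comap Y inferInstance)
    (f := (s ∩ X ⁻¹' Xr).indicator (fun _ => (1 : ℝ))) (μ := P)
  refine condExp_char hY.comap_le _ s hs _ (hsm.const_mul _) ?_ ?_
  · refine Integrable.const_mul ?_ _
    refine integrable_of_integrable_trim hY.comap_le ?_
    rw [ht]
    exact hint.trim _ hsm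
  · intro t htm
    have e : ∀ Q : Measure Ω, Q.trim hY.comap_le = P.trim hY.comap_le →
      ∫ x in t, (P⟦s ∩ X ⁻¹' Xr | MeasurableSpace.comap Y inferInstance⟧) x ∂Q
      = ∫ x in t, (P⟦s ∩ X ⁻¹' Xr | MeasurableSpace.comap Y inferInstance⟧) x
          ∂(P.trim hY.comap_le) := by
      intro Q hQ
      rw [← hQ, setIntegral_trim hY.comap_le hsm htm]
    rw [integral_const_mul, e _ ht, ← e P rfl,
      setIntegral_condProb hY.comap_le P _ _ (hs.inter (hX hXr)) htm, cond_real_apply' P (hX hXr)]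
    congr 2
    ext; simp; tauto

include hU hX hM hXr h0 F1 in
lemma cond_markov : CondIndepFun (MeasurableSpace.comap Y inferInstance) hY.comap_le U X
    (ProbabilityTheory.cond P (X ⁻¹' Xr)) := by
  have := cond_isProbabilityMeasure h0
  rw [condIndepFun_iff_condExp_inter_preimage_eq_mul hU hX] at hM ⊢
  intro a c ha hc
  have hac : ProbabilityTheory.cond P (X ⁻¹' Xr) ≪ P := cond_absolutelyContinuous
  have hα : P.real (X ⁻¹' Xr) ≠ 0 := by
    simp [Measure.real, ENNReal.toReal_eq_zero_iff, h0]
  have e1 := hac.ae_le (hM a (c ∩ Xr) ha (hc.inter hXr))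
  have e2 := hac.ae_le (hM a Xr ha hXr)
  have e3 := hac.ae_le (condProb_const P Y hY (X ⁻¹' Xr) (hX hXr) F1)
  filter_upwards [e1, e2, e3, cond_condProb P Y X hY hX Xr hXr h0 F1 _ ((hU ha).inter (hX hc)),
    cond_condProb P Y X hY hX Xr hXr h0 F1 _ (hU ha),
    cond_condProb P Y X hY hX Xr hXr h0 F1 _ (hX hc)] with ω e1 e2 e3 d1 d2 d3
  rw [← d1, ← d2, ← d3, Set.inter_assoc, ← Set.preimage_inter, e1, e2, ← e3]
  field_simp

end dir1

section dir2

open Classical in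
/-- The glued variable. -/
noncomputable def glue {Ω : Type*} (X : Ω → ℝ) (Xr : Set ℝ) : Ω × ℝ → ℝ :=
  fun p => if p.2 ∈ Xr then X p.1 else p.2

lemma glue_measurable {Ω : Type*} [MeasurableSpace Ω] {X : Ω → ℝ} (hX : Measurable X)
    {Xr : Set ℝ} (hXr : MeasurableSet Xr) : Measurable (glue X Xr) :=
  Measurable.ite (measurable_snd hXr) (hX.comp measurable_fst) measurable_snd

lemma glue_preimage {Ω : Type*} (X : Ω → ℝ) (Xr : Set ℝ) (s : Set Ω) (c : Set ℝ) :
    Prod.fst ⁻¹' s ∩ glue X Xr ⁻¹' c = (s ∩ X ⁻¹' c) ×ˢ Xr ∪ s ×ˢ (c ∩ Xrᶜ) := by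
  ext p
  by_cases h : p.2 ∈ Xr <;> simp [glue, h]

lemma glue_measure {Ω : Type*} [MeasurableSpace Ω] (P' : Measure Ω) [IsProbabilityMeasure P']
    (ν : Measure ℝ) [IsProbabilityMeasure ν] {X : Ω → ℝ} (hX : Measurable X)
    {Xr : Set ℝ} (hXr : MeasurableSet Xr) (s : Set Ω) (hs : MeasurableSet s)
    (c : Set ℝ) (hc : MeasurableSet c) :
    (P'.prod ν) (Prod.fst ⁻¹' s ∩ glue X Xr ⁻¹' c)
      = P' (s ∩ X ⁻¹' c) * ν Xr + P' s * ν (c ∩ Xrᶜ) := by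
  rw [glue_preimage, measure_union _ (hs.prod (hc.inter hXr.compl)), Measure.prod_prod,
    Measure.prod_prod]
  rw [Set.disjoint_left]
  rintro p ⟨_, h⟩ ⟨_, _, h'⟩
  exact h' h

lemma prod_condProb {Ω : Type*} [MeasurableSpace Ω] (P' : Measure Ω) [IsProbabilityMeasure P']
    (ν : Measure ℝ) [IsProbabilityMeasure ν] {Y : Ω → ℝ} (hY : Measurable Y)
    (s : Set Ω) (hs : MeasurableSet s) (T : Set ℝ) (hT : MeasurableSet T) :
    (fun p : Ω × ℝ => (P'⟦s | MeasurableSpace.comap Y inferInstance⟧) p.1 * ν.real T)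
    =ᵐ[P'.prod ν]
    (P'.prod ν)⟦s ×ˢ T | MeasurableSpace.comap (fun p : Ω × ℝ => Y p.1) inferInstance⟧ := by
  have hY' : Measurable (fun p : Ω × ℝ => Y p.1) := by fun_prop
  have hsm := stronglyMeasurable_condExp (m := MeasurableSpace.comap Y inferInstance)
    (f := s.indicator (fun _ => (1 : ℝ))) (μ := P')
  have hint := integrable_condExp (m := MeasurableSpace.comap Y inferInstance)
    (f := s.indicator (fun _ => (1 : ℝ))) (μ := P')
  refine condExp_char hY'.comap_le _ _ (hs.prod hT) _ ?_ ?_ ?_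
  · refine StronglyMeasurable.mul_const ?_ _
    refine hsm.comp_measurable (g := Prod.fst) ?_
    rintro t ⟨b, hb, rfl⟩
    exact ⟨b, hb, rfl⟩
  · exact (hint.comp_fst ν).mul_const _
  · rintro t ⟨b, hb, rfl⟩
    have e : (fun p : Ω × ℝ => Y p.1) ⁻¹' b = (Y ⁻¹' b) ×ˢ Set.univ := by ext; simp
    rw [e, setIntegral_prod_mul (fun x => (P'⟦s | MeasurableSpace.comap Y inferInstance⟧) x)
      (fun _ => ν.real T), setIntegral_condProb hY.comap_le P' _ _ hs ⟨b, hb, rfl⟩,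
      Set.prod_inter_prod, measureReal_prod_prod]
    simp

lemma glue_condProb {Ω : Type*} [MeasurableSpace Ω] (P' : Measure Ω) [IsProbabilityMeasure P']
    (ν : Measure ℝ) [IsProbabilityMeasure ν] {X Y : Ω → ℝ} (hX : Measurable X) (hY : Measurable Y)
    {Xr : Set ℝ} (hXr : MeasurableSet Xr) (s : Set Ω) (hs : MeasurableSet s)
    (c : Set ℝ) (hc : MeasurableSet c) :
    (fun p : Ω × ℝ => (P'⟦s ∩ X ⁻¹' c | MeasurableSpace.comap Y inferInstance⟧) p.1 * ν.real Xr
      + (P'⟦s | MeasurableSpace.comap Y inferInstance⟧) p.1 * ν.real (c ∩ Xrᶜ))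
    =ᵐ[P'.prod ν]
    (P'.prod ν)⟦Prod.fst ⁻¹' s ∩ glue X Xr ⁻¹' c |
      MeasurableSpace.comap (fun p : Ω × ℝ => Y p.1) inferInstance⟧ := by
  have hd : Disjoint ((s ∩ X ⁻¹' c) ×ˢ Xr) (s ×ˢ (c ∩ Xrᶜ)) := by
    rw [Set.disjoint_left]
    rintro p ⟨_, h⟩ ⟨_, _, h'⟩
    exact h' h
  rw [glue_preimage, Set.indicator_union_of_disjoint hd]
  have m1 : MeasurableSet ((s ∩ X ⁻¹' c) ×ˢ Xr) := (hs.inter (hX hc)).prod hXr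
  have m2 : MeasurableSet (s ×ˢ (c ∩ Xrᶜ)) := hs.prod (hc.inter hXr.compl)
  have h := condExp_add (μ := P'.prod ν)
    (((integrable_const (1 : ℝ)).indicator m1)) (((integrable_const (1 : ℝ)).indicator m2))
    (MeasurableSpace.comap (fun p : Ω × ℝ => Y p.1) inferInstance)
  refine Filter.EventuallyEq.trans ?_ h.symm
  filter_upwards [prod_condProb P' ν hY _ (hs.inter (hX hc)) Xr hXr,
    prod_condProb P' ν hY s hs (c ∩ Xrᶜ) (hc.inter hXr.compl)] with p h1 h2
  rw [Pi.add_apply, ← h1, ← h2]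

lemma glue_markov {Ω A : Type*} [MeasurableSpace Ω] [StandardBorelSpace Ω] [MeasurableSpace A]
    (P' : Measure Ω) [IsProbabilityMeasure P']
    (ν : Measure ℝ) [IsProbabilityMeasure ν] {U : Ω → A} {X Y : Ω → ℝ} (hU : Measurable U)
    (hX : Measurable X) (hY : Measurable Y)
    (hM : CondIndepFun (MeasurableSpace.comap Y inferInstance) hY.comap_le U X P')
    {Xr : Set ℝ} (hXr : MeasurableSet Xr) (hY' : Measurable (fun p : Ω × ℝ => Y p.1)) :
    CondIndepFun (MeasurableSpace.comap (fun p : Ω × ℝ => Y p.1) inferInstance) hY'.comap_le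
      (fun p : Ω × ℝ => U p.1) (glue X Xr) (P'.prod ν) := by
  rw [condIndepFun_iff_condExp_inter_preimage_eq_mul (by fun_prop) (glue_measurable hX hXr)]
  rw [condIndepFun_iff_condExp_inter_preimage_eq_mul hU hX] at hM
  intro a c ha hc
  have e0 : (fun p : Ω × ℝ => U p.1) ⁻¹' a = Prod.fst ⁻¹' (U ⁻¹' a) := rfl
  have e1 := glue_condProb P' ν hX hY hXr _ (hU ha) c hc
  have e2 := glue_condProb P' ν hX hY hXr Set.univ MeasurableSet.univ c hc
  have e3 := prod_condProb P' ν hY _ (hU ha) Set.univ MeasurableSet.univ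
  have e4 : (U ⁻¹' a) ×ˢ (Set.univ : Set ℝ) = Prod.fst ⁻¹' (U ⁻¹' a) := by ext; simp
  have e5 := Measure.quasiMeasurePreserving_fst (μ := P') (ν := ν) |>.ae (hM a c ha hc)
  rw [e4] at e3
  simp only [Set.preimage_univ, Set.univ_inter, Set.indicator_univ, condExp_const hY.comap_le]
    at e2
  rw [e0]
  filter_upwards [e1, e2, e3, e5] with p e1 e2 e3 e5
  rw [← e1, ← e2, ← e3, e5]
  simp
  ring

end dir2

lemma real_pair {Ω : Type*} [MeasurableSpace Ω] {P : Measure Ω} {Y X : Ω → ℝ}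
    (hY : Measurable Y) (hX : Measurable X) {μ : Measure (ℝ × ℝ)}
    (h : P.map (fun ω => (Y ω, X ω)) = μ) {b c : Set ℝ} (hb : MeasurableSet b)
    (hc : MeasurableSet c) : P (X ⁻¹' c ∩ Y ⁻¹' b) = μ (b ×ˢ c) := by
  rw [← h, Measure.map_apply (by fun_prop) (hb.prod hc), Set.mk_preimage_prod, Set.inter_comm]

lemma real_snd {Ω : Type*} [MeasurableSpace Ω] {P : Measure Ω} {Y X : Ω → ℝ}
    (hY : Measurable Y) (hX : Measurable X) {μ : Measure (ℝ × ℝ)}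
    (h : P.map (fun ω => (Y ω, X ω)) = μ) {c : Set ℝ}
    (hc : MeasurableSet c) : P (X ⁻¹' c) = μ (Set.univ ×ˢ c) := by
  rw [← real_pair hY hX h MeasurableSet.univ hc]; simp

lemma real_fst {Ω : Type*} [MeasurableSpace Ω] {P : Measure Ω} {Y X : Ω → ℝ}
    (hY : Measurable Y) (hX : Measurable X) {μ : Measure (ℝ × ℝ)}
    (h : P.map (fun ω => (Y ω, X ω)) = μ) {b : Set ℝ}
    (hb : MeasurableSet b) : P (Y ⁻¹' b) = μ (b ×ˢ Set.univ) := by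
  rw [← real_pair hY hX h hb MeasurableSet.univ]; simp

/-- Conditioning commutes with taking the joint law. -/
lemma cond_pair {Ω : Type*} [MeasurableSpace Ω] {P : Measure Ω} {Y X : Ω → ℝ}
    (hY : Measurable Y) (hX : Measurable X) {μ : Measure (ℝ × ℝ)}
    (h : P.map (fun ω => (Y ω, X ω)) = μ) {Xr : Set ℝ} (hXr : MeasurableSet Xr) :
    (ProbabilityTheory.cond P (X ⁻¹' Xr)).map (fun ω => (Y ω, X ω))
      = ProbabilityTheory.cond μ (Set.univ ×ˢ Xr) := by
  rw [ProbabilityTheory.cond, ProbabilityTheory.cond, Measure.map_smul, real_snd hY hX h hXr, ← h,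
    Measure.restrict_map (by fun_prop) (MeasurableSet.univ.prod hXr), Set.mk_preimage_prod,
    Set.preimage_univ, Set.univ_inter]

lemma mutInfo_congr {Ω Ω' A : Type*} [MeasurableSpace Ω] [MeasurableSpace Ω'] [MeasurableSpace A]
    {P : Measure Ω} {P' : Measure Ω'} {U : Ω → A} {X : Ω → ℝ} {U' : Ω' → A} {X' : Ω' → ℝ}
    (hU : Measurable U) (hX : Measurable X) (hU' : Measurable U') (hX' : Measurable X')
    (h : P.map (fun ω => (U ω, X ω)) = P'.map (fun ω => (U' ω, X' ω))) :
    mutInfoE U X P = mutInfoE U' X' P' := by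
  have h1 := congrArg (Measure.map Prod.fst) h
  have h2 := congrArg (Measure.map Prod.snd) h
  rw [Measure.map_map (by fun_prop) (by fun_prop),
    Measure.map_map (by fun_prop) (by fun_prop)] at h1 h2
  change P.map U = P'.map U' at h1
  change P.map X = P'.map X' at h2
  rw [mutInfoE, mutInfoE, h, h1, h2]

section main

variable {μ : Measure (ℝ × ℝ)} [IsProbabilityMeasure μ] {Xr : Set ℝ} (hXr : MeasurableSet Xr)
  (h0 : μ (Set.univ ×ˢ Xr) ≠ 0)
  (G1 : ∀ b, MeasurableSet b → μ (b ×ˢ Xr) = μ (b ×ˢ Set.univ) * μ (Set.univ ×ˢ Xr))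
  (G2 : ∀ c, MeasurableSet c → ∀ b, MeasurableSet b →
      μ (b ×ˢ (c ∩ Xrᶜ)) = μ (b ×ˢ Set.univ) * μ (Set.univ ×ˢ (c ∩ Xrᶜ)))

include hXr h0 G1 G2

lemma witness_down (w : MarkovWitness μ) :
    ∃ w' : MarkovWitness (ProbabilityTheory.cond μ (Set.univ ×ˢ Xr)),
      mutInfoE w'.U w'.X w'.P = mutInfoE w.U w.X w.P ∧
      (mutInfoE w.U w.Y w.P).toReal
        = (μ (Set.univ ×ˢ Xr)).toReal * (mutInfoE w'.U w'.Y w'.P).toReal := by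
  have hs := fun {c : Set ℝ} (hc : MeasurableSet c) => real_snd w.measX w.measY w.law_eq hc
  have hf := fun {c : Set ℝ} (hc : MeasurableSet c) => real_fst w.measX w.measY w.law_eq hc
  have hp := fun {b c : Set ℝ} (hb : MeasurableSet b) (hc : MeasurableSet c) =>
    real_pair w.measX w.measY w.law_eq hb hc
  have h0' : w.P (w.Y ⁻¹' Xr) ≠ 0 := by rwa [hs hXr]
  have F1 : ∀ b, MeasurableSet b → w.P.real (w.Y ⁻¹' Xr ∩ w.X ⁻¹' b)
      = w.P.real (w.X ⁻¹' b) * w.P.real (w.Y ⁻¹' Xr) := by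
    intro b hb
    simp only [Measure.real, hs hXr, hf hb, hp hb hXr, G1 b hb, ENNReal.toReal_mul]
  have F2 : ∀ c, MeasurableSet c → ∀ b, MeasurableSet b →
      w.P.real (w.Y ⁻¹' (c ∩ Xrᶜ) ∩ w.X ⁻¹' b)
      = w.P.real (w.X ⁻¹' b) * w.P.real (w.Y ⁻¹' (c ∩ Xrᶜ)) := by
    intro c hc b hb
    have hc' := hc.inter hXr.compl
    simp only [Measure.real, hs hc', hf hb, hp hb hc', G2 c hc b hb, ENNReal.toReal_mul]
  have := cond_isProbabilityMeasure h0'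
  refine ⟨{ Ω := w.Ω, P := ProbabilityTheory.cond w.P (w.Y ⁻¹' Xr), A := w.A, U := w.U, X := w.X,
            Y := w.Y, measU := w.measU, measX := w.measX, measY := w.measY,
            law_eq := cond_pair w.measX w.measY w.law_eq hXr,
            markov := cond_markov w.P w.U w.X w.Y w.measU w.measX w.measY w.markov Xr hXr h0' F1 },
          ?_, ?_⟩
  · exact cond_mutInfo_UY w.P w.U w.X w.Y w.measU w.measX w.measY w.markov Xr hXr h0' F1
  · rw [← hs hXr]
    exact cond_mutInfo_UX w.P w.U w.X w.Y w.measU w.measX w.measY w.markov Xr hXr h0' F1 F2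

lemma witness_up (w : MarkovWitness (ProbabilityTheory.cond μ (Set.univ ×ˢ Xr))) :
    ∃ w' : MarkovWitness μ,
      mutInfoE w.U w.X w.P = mutInfoE w'.U w'.X w'.P ∧
      (mutInfoE w'.U w'.Y w'.P).toReal
        = (μ (Set.univ ×ˢ Xr)).toReal * (mutInfoE w.U w.Y w.P).toReal := by
  have hν : IsProbabilityMeasure (μ.map Prod.snd) :=
    Measure.isProbabilityMeasure_map measurable_snd.aemeasurable
  have hνa : ∀ c, MeasurableSet c → μ.map Prod.snd c = μ (Set.univ ×ˢ c) := by
    intro c hc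
    rw [Measure.map_apply measurable_snd hc, Set.univ_prod]
  have hT : MeasurableSet (Set.univ ×ˢ Xr : Set (ℝ × ℝ)) := MeasurableSet.univ.prod hXr
  have hwp : ∀ b c, MeasurableSet b → MeasurableSet c →
      w.P (w.X ⁻¹' b ∩ w.Y ⁻¹' c) * μ (Set.univ ×ˢ Xr) = μ (b ×ˢ (c ∩ Xr)) := by
    intro b c hb hc
    rw [Set.inter_comm, real_pair w.measX w.measY w.law_eq hb hc, cond_apply hT, mul_comm,
      ← mul_assoc, ENNReal.mul_inv_cancel h0 (measure_ne_top _ _), one_mul,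
      Set.prod_inter_prod, Set.univ_inter, Set.inter_comm]
  have hwX : ∀ b, MeasurableSet b → w.P (w.X ⁻¹' b) = μ (b ×ˢ Set.univ) := by
    intro b hb
    have h := hwp b Set.univ hb MeasurableSet.univ
    rw [Set.preimage_univ, Set.inter_univ, Set.univ_inter, G1 b hb] at h
    exact (ENNReal.mul_left_inj h0 (measure_ne_top _ _)).1 h
  have hwY : ∀ᵐ ω ∂w.P, w.Y ω ∈ Xr := by
    have : w.P (w.Y ⁻¹' Xr) = 1 := by
      rw [real_snd w.measX w.measY w.law_eq hXr, cond_apply_self h0 (measure_ne_top _ _)]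
    exact (prob_compl_eq_zero_iff (w.measY hXr)).2 this
  have hYm := glue_measurable w.measY hXr
  have hX' : Measurable (fun p : w.Ω × ℝ => w.X p.1) := w.measX.comp measurable_fst
  have hU' : Measurable (fun p : w.Ω × ℝ => w.U p.1) := w.measU.comp measurable_fst
  let w' : MarkovWitness μ :=
    { Ω := w.Ω × ℝ
      P := w.P.prod (μ.map Prod.snd)
      A := w.A
      U := fun p => w.U p.1
      X := fun p => w.X p.1
      Y := glue w.Y Xr
      measU := hU'
      measX := hX'
      measY := hYm
      law_eq := by
        refine Measure.ext_prod ?_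
        intro b c hb hc
        rw [Measure.map_apply (hX'.prodMk hYm) (hb.prod hc), Set.mk_preimage_prod]
        refine (glue_measure w.P (μ.map Prod.snd) w.measY hXr _ (w.measX hb) c hc).trans ?_
        rw [hνa _ hXr, hνa _ (hc.inter hXr.compl), hwp b c hb hc, hwX b hb, ← G2 c hc b hb,
          ← measure_union _ (hb.prod (hc.inter hXr.compl)), ← Set.prod_union,
          Set.inter_union_compl]
        rw [Set.disjoint_left]
        rintro p ⟨_, _, h⟩ ⟨_, _, h'⟩
        exact h' h
      markov := glue_markov w.P (μ.map Prod.snd) w.measU w.measY w.measX w.markov hXr hX' }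
  have key : (ProbabilityTheory.cond (w.P.prod (μ.map Prod.snd)) (glue w.Y Xr ⁻¹' Xr)).map
      (fun p => (w.U p.1, glue w.Y Xr p)) = w.P.map (fun ω => (w.U ω, w.Y ω)) := by
    have hK : (w.P.prod (μ.map Prod.snd)) (glue w.Y Xr ⁻¹' Xr) = μ (Set.univ ×ˢ Xr) :=
      real_snd hX' hYm w'.law_eq hXr
    refine Measure.ext_prod ?_
    intro a c ha hc
    rw [Measure.map_apply (hU'.prodMk hYm) (ha.prod hc),
      Measure.map_apply (w.measU.prodMk w.measY) (ha.prod hc),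
      Set.mk_preimage_prod, Set.mk_preimage_prod, cond_apply (hYm hXr), hK]
    have e : glue w.Y Xr ⁻¹' Xr ∩ ((fun p : w.Ω × ℝ => w.U p.1) ⁻¹' a ∩ glue w.Y Xr ⁻¹' c)
        = Prod.fst ⁻¹' (w.U ⁻¹' a) ∩ glue w.Y Xr ⁻¹' (c ∩ Xr) := by
      ext; simp; tauto
    rw [e, glue_measure w.P (μ.map Prod.snd) w.measY hXr _ (w.measU ha) _ (hc.inter hXr),
      hνa _ hXr, Set.inter_assoc c, Set.inter_compl_self, Set.inter_empty, measure_empty,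
      mul_zero, add_zero, mul_comm, mul_assoc, ENNReal.mul_inv_cancel h0 (measure_ne_top _ _),
      mul_one]
    refine measure_congr ?_
    filter_upwards [hwY] with ω hω
    refine propext ?_
    change (w.U ω ∈ a ∧ w.Y ω ∈ c ∧ w.Y ω ∈ Xr) ↔ (w.U ω ∈ a ∧ w.Y ω ∈ c)
    tauto
  have hXlaw : (w.P.prod (μ.map Prod.snd)).map (fun p => (w.U p.1, w.X p.1))
      = w.P.map (fun ω => (w.U ω, w.X ω)) := by
    have := (measurePreserving_fst (μ := w.P) (ν := μ.map Prod.snd)).map_eq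
    conv_rhs => rw [← this, Measure.map_map (w.measU.prodMk w.measX) measurable_fst]
    rfl
  obtain hs := real_snd hX' hYm w'.law_eq hXr
  have h0' : w'.P (w'.Y ⁻¹' Xr) ≠ 0 := by
    change (w.P.prod (μ.map Prod.snd)) (glue w.Y Xr ⁻¹' Xr) ≠ 0
    rwa [real_snd hX' hYm w'.law_eq hXr]
  have F1 : ∀ b, MeasurableSet b → w'.P.real (w'.Y ⁻¹' Xr ∩ w'.X ⁻¹' b)
      = w'.P.real (w'.X ⁻¹' b) * w'.P.real (w'.Y ⁻¹' Xr) := by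
    intro b hb
    simp only [Measure.real, real_snd w'.measX w'.measY w'.law_eq hXr,
      real_fst w'.measX w'.measY w'.law_eq hb, real_pair w'.measX w'.measY w'.law_eq hb hXr,
      G1 b hb, ENNReal.toReal_mul]
  have F2 : ∀ c, MeasurableSet c → ∀ b, MeasurableSet b →
      w'.P.real (w'.Y ⁻¹' (c ∩ Xrᶜ) ∩ w'.X ⁻¹' b)
      = w'.P.real (w'.X ⁻¹' b) * w'.P.real (w'.Y ⁻¹' (c ∩ Xrᶜ)) := by
    intro c hc b hb
    have hc' := hc.inter hXr.compl
    simp only [Measure.real, real_snd w'.measX w'.measY w'.law_eq hc',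
      real_fst w'.measX w'.measY w'.law_eq hb, real_pair w'.measX w'.measY w'.law_eq hb hc',
      G2 c hc b hb, ENNReal.toReal_mul]
  refine ⟨w', ?_, ?_⟩
  · exact mutInfo_congr w.measU w.measX hU' hX' hXlaw.symm
  · rw [cond_mutInfo_UX w'.P w'.U w'.X w'.Y w'.measU w'.measX w'.measY w'.markov Xr hXr h0' F1 F2,
      real_snd w'.measX w'.measY w'.law_eq hXr]
    congr 2
    exact mutInfo_congr hU' hYm w.measU w.measY key

end main

/-- **The inverse hypercontractivity coefficient under a rare/dominant decomposition.**
If `X_r` is a Borel set with `α = P(X ∈ X_r) ∈ (0,1)`, `X` and `Y` are independent conditioned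
on `{X ∉ X_r}`, and the conditional law of `Y` given `{X ∈ X_r}` equals that given `{X ∉ X_r}`,
then `s(Y;X) = α · s(Y;X_r)`, the latter computed under `P(· | X ∈ X_r)`. -/
theorem hc_reverse_rare_dominant {Ω : Type*} [MeasurableSpace Ω] (P : Measure Ω)
    [IsProbabilityMeasure P] (X Y : Ω → ℝ) (hX : Measurable X) (hY : Measurable Y)
    (Xr : Set ℝ) (hXr : MeasurableSet Xr)
    (hα0 : 0 < (P (X ⁻¹' Xr)).toReal) (hα1 : (P (X ⁻¹' Xr)).toReal < 1)
    (hindep : IndepFun X Y (ProbabilityTheory.cond P (X ⁻¹' Xr)ᶜ))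
    (hmarg : (ProbabilityTheory.cond P (X ⁻¹' Xr)).map Y
      = (ProbabilityTheory.cond P (X ⁻¹' Xr)ᶜ).map Y) :
    hc P Y X = (P (X ⁻¹' Xr)).toReal * hc (ProbabilityTheory.cond P (X ⁻¹' Xr)) Y X := by
  have hfin : ∀ s, P s ≠ ⊤ := fun s => measure_ne_top P s
  have hK : MeasurableSet (X ⁻¹' Xr) := hX hXr
  have hK0 : P (X ⁻¹' Xr) ≠ 0 := by
    intro h
    simp [h] at hα0
  have hKc : P (X ⁻¹' Xr)ᶜ ≠ 0 := by
    intro h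
    rw [prob_compl_eq_zero_iff hK] at h
    simp [h] at hα1
  have hμ : IsProbabilityMeasure (P.map (fun ω => (Y ω, X ω))) :=
    Measure.isProbabilityMeasure_map (hY.prodMk hX).aemeasurable
  have hs := fun {c : Set ℝ} (hc : MeasurableSet c) => real_snd (P := P) hY hX rfl hc
  have hf := fun {c : Set ℝ} (hc : MeasurableSet c) => real_fst (P := P) hY hX rfl hc
  have hp := fun {b c : Set ℝ} (hb : MeasurableSet b) (hc : MeasurableSet c) =>
    real_pair (P := P) hY hX rfl hb hc
  -- real-valued form of the hypotheses
  have hsum : P.real (X ⁻¹' Xr) + P.real (X ⁻¹' Xr)ᶜ = 1 := by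
    rw [probReal_compl_eq_one_sub hK]; ring
  have hKr : P.real (X ⁻¹' Xr) ≠ 0 := hα0.ne'
  have hKcr : P.real (X ⁻¹' Xr)ᶜ ≠ 0 := by
    simp [Measure.real, ENNReal.toReal_eq_zero_iff, hKc]
  have hm : ∀ b, MeasurableSet b → (P.real (X ⁻¹' Xr))⁻¹ * P.real (X ⁻¹' Xr ∩ Y ⁻¹' b)
      = (P.real (X ⁻¹' Xr)ᶜ)⁻¹ * P.real ((X ⁻¹' Xr)ᶜ ∩ Y ⁻¹' b) := by
    intro b hb
    have h := congrArg (fun m => m.real b) hmarg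
    simp only [Measure.real, Measure.map_apply hY hb] at h
    change (ProbabilityTheory.cond P (X ⁻¹' Xr)).real (Y ⁻¹' b)
      = (ProbabilityTheory.cond P (X ⁻¹' Xr)ᶜ).real (Y ⁻¹' b) at h
    rwa [cond_real_apply' P hK, cond_real_apply' P hK.compl] at h
  have hadd : ∀ b, MeasurableSet b → P.real (X ⁻¹' Xr ∩ Y ⁻¹' b)
      + P.real ((X ⁻¹' Xr)ᶜ ∩ Y ⁻¹' b) = P.real (Y ⁻¹' b) := by
    intro b hb
    rw [Set.inter_comm, Set.inter_comm _ (Y ⁻¹' b), ← Set.sdiff_eq]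
    exact measureReal_inter_add_sdiff hK
  have R1 : ∀ b, MeasurableSet b →
      P.real (X ⁻¹' Xr ∩ Y ⁻¹' b) = P.real (Y ⁻¹' b) * P.real (X ⁻¹' Xr) := by
    intro b hb
    have h1 := hm b hb
    have h2 := hadd b hb
    field_simp at h1
    rw [← h2]
    linear_combination (-P.real (X ⁻¹' Xr ∩ Y ⁻¹' b)) * hsum + h1
  have R1c : ∀ b, MeasurableSet b →
      P.real ((X ⁻¹' Xr)ᶜ ∩ Y ⁻¹' b) = P.real (Y ⁻¹' b) * P.real (X ⁻¹' Xr)ᶜ := by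
    intro b hb
    linear_combination hadd b hb - R1 b hb - P.real (Y ⁻¹' b) * hsum
  have R2 : ∀ c, MeasurableSet c → ∀ b, MeasurableSet b →
      P.real (X ⁻¹' (c ∩ Xrᶜ) ∩ Y ⁻¹' b) = P.real (Y ⁻¹' b) * P.real (X ⁻¹' (c ∩ Xrᶜ)) := by
    intro c hc b hb
    have h := congrArg ENNReal.toReal
      ((indepFun_iff_measure_inter_preimage_eq_mul.1 hindep) c b hc hb)
    rw [ENNReal.toReal_mul] at h
    change (ProbabilityTheory.cond P (X ⁻¹' Xr)ᶜ).real _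
      = (ProbabilityTheory.cond P (X ⁻¹' Xr)ᶜ).real _
        * (ProbabilityTheory.cond P (X ⁻¹' Xr)ᶜ).real _ at h
    rw [cond_real_apply' P hK.compl, cond_real_apply' P hK.compl, cond_real_apply' P hK.compl,
      R1c b hb] at h
    have e1 : (X ⁻¹' Xr)ᶜ ∩ (X ⁻¹' c ∩ Y ⁻¹' b) = X ⁻¹' (c ∩ Xrᶜ) ∩ Y ⁻¹' b := by
      ext; simp; tauto
    have e2 : (X ⁻¹' Xr)ᶜ ∩ X ⁻¹' c = X ⁻¹' (c ∩ Xrᶜ) := by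
      ext; simp; tauto
    rw [e1, e2] at h
    field_simp at h
    linear_combination h
  have G1 : ∀ b, MeasurableSet b → P.map (fun ω => (Y ω, X ω)) (b ×ˢ Xr)
      = P.map (fun ω => (Y ω, X ω)) (b ×ˢ Set.univ)
        * P.map (fun ω => (Y ω, X ω)) (Set.univ ×ˢ Xr) := by
    intro b hb
    rw [← hp hb hXr, ← hf hb, ← hs hXr,
      ← ENNReal.toReal_eq_toReal_iff' (by finiteness) (by finiteness), ENNReal.toReal_mul]
    exact R1 b hb
  have G2 : ∀ c, MeasurableSet c → ∀ b, MeasurableSet b →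
      P.map (fun ω => (Y ω, X ω)) (b ×ˢ (c ∩ Xrᶜ))
      = P.map (fun ω => (Y ω, X ω)) (b ×ˢ Set.univ)
        * P.map (fun ω => (Y ω, X ω)) (Set.univ ×ˢ (c ∩ Xrᶜ)) := by
    intro c hc b hb
    have hc' := hc.inter hXr.compl
    rw [← hp hb hc', ← hf hb, ← hs hc',
      ← ENNReal.toReal_eq_toReal_iff' (by finiteness) (by finiteness), ENNReal.toReal_mul]
    exact R2 c hc b hb
  have hcp := cond_pair (P := P) hY hX rfl hXr
  have h0 : P.map (fun ω => (Y ω, X ω)) (Set.univ ×ˢ Xr) ≠ 0 := by rwa [← hs hXr]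
  unfold hc
  rw [hcp, ← smul_eq_mul, ← Real.sSup_smul_of_nonneg hα0.le]
  congr 1
  ext t
  rw [Set.mem_smul_set]
  constructor
  · rintro ⟨w, h1, h2, rfl⟩
    obtain ⟨w', e1, e2⟩ := witness_down hXr h0 G1 G2 w
    refine ⟨_, ⟨w', by rwa [e1], by rwa [e1], rfl⟩, ?_⟩
    rw [e1, e2, hs hXr, smul_eq_mul, mul_div_assoc]
  · rintro ⟨_, ⟨w, h1, h2, rfl⟩, rfl⟩
    obtain ⟨w', e1, e2⟩ := witness_up hXr h0 G1 G2 w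
    refine ⟨w', by rwa [← e1], by rwa [← e1], ?_⟩
    rw [e1, e2, hs hXr, smul_eq_mul, mul_div_assoc]
end

section
/- Let (X,Y) be a pair of real-valued random variables and let X_r be a Borel subset of ℝ with α := P(X ∈ X_r) ∈ (0,1), such that: (i) X and Y are independent conditioned on the event {X ∉ X_r}, and (ii) the conditional law of Y given {X ∈ X_r} equals the conditional law of Y given {X ∉ X_r}. Then for every random variable U such that U and X are conditionally independent given Y (the Markov chain U–Y–X), one has I(U;X) = α · I(U;X | X ∈ X_r) and I(U;Y) = I(U;Y | X ∈ X_r), where the conditional mutual informations on the right are computed under the conditional probability measure P(· | X ∈ X_r). -/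
open MeasureTheory ProbabilityTheory Real

open InformationTheory Set in
lemma klDivE_eq_klDiv {α : Type*} [MeasurableSpace α] (μ ν : Measure α)
    [IsProbabilityMeasure μ] [IsProbabilityMeasure ν] :
    klDivE μ ν = ((klDiv μ ν : ENNReal) : EReal) := by
  unfold klDivE
  split_ifs with h
  · rw [klDiv_of_ac_of_integrable h.1 h.2]
    have h0 := integral_llr_add_sub_measure_univ_nonneg h.1 h.2
    simp only [probReal_univ, add_sub_cancel_right] at h0 ⊢
    rw [EReal.coe_ennreal_ofReal, max_eq_left h0]
  · have : klDiv μ ν = ⊤ := by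
      by_contra hne
      exact h (klDiv_ne_top_iff.mp hne)
    rw [this, EReal.coe_ennreal_top]

open InformationTheory Set in
lemma klDiv_restrict_of_ac {α : Type*} [MeasurableSpace α] {μ ν : Measure α}
    [IsFiniteMeasure μ] [IsFiniteMeasure ν] (h : μ ≪ ν) {T : Set α} (hT : MeasurableSet T) :
    klDiv (μ.restrict T) (ν.restrict T)
      = ∫⁻ x in T, ENNReal.ofReal (klFun (μ.rnDeriv ν x).toReal) ∂ν := by
  rw [klDiv_eq_lintegral_klFun_of_ac (h.restrict T)]
  have h1 : μ.restrict T = (ν.restrict T).withDensity (μ.rnDeriv ν) := by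
    conv_lhs => rw [← Measure.withDensity_rnDeriv_eq μ ν h]
    rw [restrict_withDensity hT]
  have h2 : (μ.restrict T).rnDeriv (ν.restrict T) =ᵐ[ν.restrict T] μ.rnDeriv ν := by
    conv_lhs => rw [h1]
    exact Measure.rnDeriv_withDensity _ (Measure.measurable_rnDeriv _ _)
  apply lintegral_congr_ae
  filter_upwards [h2] with x hx
  rw [hx]

open InformationTheory Set in
lemma klDiv_eq_restrict {α : Type*} [MeasurableSpace α] {μ ν : Measure α}
    [IsFiniteMeasure μ] [IsFiniteMeasure ν] {T : Set α} (hT : MeasurableSet T)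
    (hc : μ.restrict Tᶜ = ν.restrict Tᶜ) :
    klDiv μ ν = klDiv (μ.restrict T) (ν.restrict T) := by
  by_cases h : μ ≪ ν
  · have h3 := klDiv_restrict_of_ac h hT.compl
    rw [hc, klDiv_self] at h3
    rw [klDiv_restrict_of_ac h hT, klDiv_eq_lintegral_klFun_of_ac h,
      ← lintegral_add_compl _ hT, ← h3, add_zero]
  · rw [klDiv_of_not_ac h, klDiv_of_not_ac]
    intro h'
    apply h
    have h4 : μ.restrict T + μ.restrict Tᶜ ≪ ν.restrict T + ν.restrict Tᶜ := by
      rw [hc]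
      exact h'.add Measure.AbsolutelyContinuous.rfl
    rwa [Measure.restrict_add_restrict_compl hT, Measure.restrict_add_restrict_compl hT] at h4

/-- If `U — Y — X` and the event `X ∈ D` is independent of `Y`, then it is independent
of `(U, Y)`. -/
lemma markov_indep_aux {Ω : Type*} [MeasurableSpace Ω]
    [StandardBorelSpace Ω] (P : Measure Ω) [IsProbabilityMeasure P]
    (X Y : Ω → ℝ) (hX : Measurable X) (hY : Measurable Y)
    {A : Type*} [MeasurableSpace A] (U : Ω → A) (hU : Measurable U)
    (hmarkov : CondIndepFun (MeasurableSpace.comap Y inferInstance) hY.comap_le U X P)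
    (D : Set ℝ) (hD : MeasurableSet D)
    (hind : ∀ B, MeasurableSet B →
      P.real (X ⁻¹' D ∩ Y ⁻¹' B) = P.real (X ⁻¹' D) * P.real (Y ⁻¹' B))
    (S : Set A) (hS : MeasurableSet S) (B : Set ℝ) (hB : MeasurableSet B) :
    P.real (U ⁻¹' S ∩ X ⁻¹' D ∩ Y ⁻¹' B) = P.real (X ⁻¹' D) * P.real (U ⁻¹' S ∩ Y ⁻¹' B) := by
  have hm := hY.comap_le
  have hset : ∀ F : Set Ω, MeasurableSet F → ∀ C, MeasurableSet C →
      ∫ ω in Y ⁻¹' C, F.indicator (fun _ => (1 : ℝ)) ω ∂P = P.real (F ∩ Y ⁻¹' C) := by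
    intro F hF C hC
    rw [integral_indicator hF, setIntegral_const, measureReal_restrict_apply hF]
    simp
  have hint : ∀ F : Set Ω, MeasurableSet F → Integrable (F.indicator (fun _ => (1 : ℝ))) P :=
    fun F hF => (integrable_const (1 : ℝ)).indicator hF
  have hconst : (fun _ => P.real (X ⁻¹' D)) =ᵐ[P]
      P[(X ⁻¹' D).indicator (fun _ => (1 : ℝ)) | MeasurableSpace.comap Y inferInstance] := by
    refine ae_eq_condExp_of_forall_setIntegral_eq hm (hint _ (hX hD))
      (fun s _ _ => (integrable_const _).integrableOn) ?_ ?_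
    · rintro s ⟨C, hC, rfl⟩ -
      rw [hset _ (hX hD) C hC, hind C hC, setIntegral_const, smul_eq_mul, mul_comm]
    · exact stronglyMeasurable_const.aestronglyMeasurable
  have hmk := (condIndepFun_iff_condExp_inter_preimage_eq_mul hU hX).mp hmarkov S D hS hD
  have hBm : MeasurableSet[MeasurableSpace.comap Y inferInstance] (Y ⁻¹' B) := ⟨B, hB, rfl⟩
  rw [← hset _ ((hU hS).inter (hX hD)) B hB, ← hset _ (hU hS) B hB,
    ← setIntegral_condExp hm (hint _ ((hU hS).inter (hX hD))) hBm,
    ← setIntegral_condExp hm (hint _ (hU hS)) hBm, ← integral_const_mul]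
  apply integral_congr_ae
  apply ae_restrict_of_ae
  filter_upwards [hmk, hconst] with ω h1 h2
  rw [h1, ← h2, mul_comm]

/-- **Mutual information identities for the reverse Markov chain under a rare/dominant
decomposition.** If `X_r` is a Borel set with `α = P(X ∈ X_r) ∈ (0,1)`, `X` and `Y` are
independent conditioned on `{X ∉ X_r}`, the conditional law of `Y` given `{X ∈ X_r}` equals that
given `{X ∉ X_r}`, and `U — Y — X` is a Markov chain, then `I(U;X) = α · I(U;X | X ∈ X_r)` and
`I(U;Y) = I(U;Y | X ∈ X_r)`, the right-hand sides computed under `P(· | X ∈ X_r)`. -/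
theorem mutInfo_rare_dominant_reverse_markov {Ω : Type*} [MeasurableSpace Ω]
    [StandardBorelSpace Ω] (P : Measure Ω) [IsProbabilityMeasure P]
    (X Y : Ω → ℝ) (hX : Measurable X) (hY : Measurable Y)
    (Xr : Set ℝ) (hXr : MeasurableSet Xr)
    (hα0 : 0 < (P (X ⁻¹' Xr)).toReal) (hα1 : (P (X ⁻¹' Xr)).toReal < 1)
    (hindep : IndepFun X Y (ProbabilityTheory.cond P (X ⁻¹' Xr)ᶜ))
    (hmarg : (ProbabilityTheory.cond P (X ⁻¹' Xr)).map Y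
      = (ProbabilityTheory.cond P (X ⁻¹' Xr)ᶜ).map Y)
    {A : Type*} [MeasurableSpace A] (U : Ω → A) (hU : Measurable U)
    (hmarkov : CondIndepFun (MeasurableSpace.comap Y inferInstance) hY.comap_le U X P) :
    mutInfoE U X P
        = (((P (X ⁻¹' Xr)).toReal : ℝ) : EReal)
            * mutInfoE U X (ProbabilityTheory.cond P (X ⁻¹' Xr)) ∧
      mutInfoE U Y P = mutInfoE U Y (ProbabilityTheory.cond P (X ⁻¹' Xr)) := by
  set E := X ⁻¹' Xr with hE
  have hEm : MeasurableSet E := hX hXr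
  have hEc : P.real Eᶜ = 1 - P.real E := probReal_compl_eq_one_sub hEm
  change 0 < P.real E at hα0
  change P.real E < 1 at hα1
  have hE0 : P E ≠ 0 := fun h => by simp [Measure.real, h] at hα0
  have hEc0 : P Eᶜ ≠ 0 := fun h => by
    have : P.real Eᶜ = 0 := by simp [Measure.real, h]
    linarith
  have : IsProbabilityMeasure (P[|E]) := cond_isProbabilityMeasure hE0
  have : IsProbabilityMeasure (P[|Eᶜ]) := cond_isProbabilityMeasure hEc0
  have hcr : ∀ F G : Set Ω, MeasurableSet F → (P[|F]).real G = (P.real F)⁻¹ * P.real (F ∩ G) :=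
    fun F G hF => by
      simp [Measure.real, cond_apply hF]
  have hm : ∀ B, MeasurableSet B → (P[|E]).real (Y ⁻¹' B) = (P[|Eᶜ]).real (Y ⁻¹' B) := by
    intro B hB
    have := congrArg (fun m => m.real B) hmarg
    simpa [map_measureReal_apply hY hB] using this
  have hsplit : ∀ F, P.real (E ∩ F) + P.real (Eᶜ ∩ F) = P.real F := by
    intro F
    have := measureReal_inter_add_sdiff (μ := P) (s := F) hEm
    rwa [Set.inter_comm, Set.diff_eq, Set.inter_comm F Eᶜ] at this
  -- `E` is independent of `Y`
  have hind1 : ∀ B, MeasurableSet B → P.real (E ∩ Y ⁻¹' B) = P.real E * P.real (Y ⁻¹' B) := by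
    intro B hB
    have h1 := hm B hB
    rw [hcr _ _ hEm, hcr _ _ hEm.compl, hEc] at h1
    have h2 := hsplit (Y ⁻¹' B)
    have h3 : 1 - P.real E ≠ 0 := by linarith
    field_simp at h1
    rw [← h2]
    linarith
  have hcY : ∀ B, MeasurableSet B → (P[|Eᶜ]).real (Y ⁻¹' B) = P.real (Y ⁻¹' B) := by
    intro B hB
    rw [← hm B hB, hcr _ _ hEm, hind1 B hB]
    field_simp
  have hind2 : ∀ C, MeasurableSet C → ∀ B, MeasurableSet B →
      P.real (X ⁻¹' (Xrᶜ ∩ C) ∩ Y ⁻¹' B) = P.real (X ⁻¹' (Xrᶜ ∩ C)) * P.real (Y ⁻¹' B) := by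
    intro C hC B hB
    have h1 : (P[|Eᶜ]).real (X ⁻¹' C ∩ Y ⁻¹' B)
        = (P[|Eᶜ]).real (X ⁻¹' C) * (P[|Eᶜ]).real (Y ⁻¹' B) := by
      simp only [Measure.real]
      rw [hindep.measure_inter_preimage_eq_mul _ _ hC hB, ENNReal.toReal_mul]
    rw [hcY B hB, hcr _ _ hEm.compl, hcr _ _ hEm.compl, hEc] at h1
    have h3 : 1 - P.real E ≠ 0 := by linarith
    field_simp at h1
    rw [Set.preimage_inter, Set.preimage_compl, ← hE, Set.inter_assoc]
    exact h1
  have key := markov_indep_aux P X Y hX hY U hU hmarkov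
  have key1 := key Xr hXr hind1
  have key2 : ∀ C, MeasurableSet C → ∀ S, MeasurableSet S →
      P.real (U ⁻¹' S ∩ (Eᶜ ∩ X ⁻¹' C)) = P.real (U ⁻¹' S) * P.real (Eᶜ ∩ X ⁻¹' C) := by
    intro C hC S hS
    have := key (Xrᶜ ∩ C) (hXr.compl.inter hC) (hind2 C hC) S hS Set.univ MeasurableSet.univ
    simp only [Set.preimage_univ, Set.inter_univ] at this
    rw [Set.preimage_inter, Set.preimage_compl, ← hE] at this
    rw [this, mul_comm]
  have hUYm : Measurable (fun ω => (U ω, Y ω)) := hU.prodMk hY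
  have hUXm : Measurable (fun ω => (U ω, X ω)) := hU.prodMk hX
  -- the law of `(U, Y)` is unchanged
  have hUY : (P[|E]).map (fun ω => (U ω, Y ω)) = P.map (fun ω => (U ω, Y ω)) := by
    refine Measure.ext_prod fun {S B} hS hB => ?_
    rw [Measure.map_apply hUYm (hS.prod hB), Measure.map_apply hUYm (hS.prod hB)]
    rw [← measureReal_eq_measureReal_iff, hcr _ _ hEm]
    have h1 := key1 S hS B hB
    have h2 : (fun ω => (U ω, Y ω)) ⁻¹' (S ×ˢ B) = U ⁻¹' S ∩ Y ⁻¹' B := rfl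
    rw [h2, ← Set.inter_assoc, Set.inter_comm E, h1, ← hE]
    field_simp
  have hU' : (P[|E]).map U = P.map U := by
    have := congrArg (fun m => m.map Prod.fst) hUY
    simpa [Measure.map_map measurable_fst hUYm, Function.comp_def] using this
  have hY' : (P[|E]).map Y = P.map Y := by
    have := congrArg (fun m => m.map Prod.snd) hUY
    simpa [Measure.map_map measurable_snd hUYm, Function.comp_def] using this
  refine ⟨?_, by unfold mutInfoE; rw [hUY, hU', hY']⟩
  have := Measure.isProbabilityMeasure_map (μ := P) hU.aemeasurable
  have := Measure.isProbabilityMeasure_map (μ := P) hX.aemeasurable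
  have := Measure.isProbabilityMeasure_map (μ := P) hUXm.aemeasurable
  have := Measure.isProbabilityMeasure_map (μ := P[|E]) hX.aemeasurable
  have := Measure.isProbabilityMeasure_map (μ := P[|E]) hUXm.aemeasurable
  unfold mutInfoE
  rw [hU', klDivE_eq_klDiv, klDivE_eq_klDiv]
  have hT : MeasurableSet (Set.univ ×ˢ Xr : Set (A × ℝ)) := MeasurableSet.univ.prod hXr
  have hTc : (Set.univ ×ˢ Xr : Set (A × ℝ))ᶜ = Set.univ ×ˢ Xrᶜ := by
    ext ⟨a, x⟩; simp
  have hcompl : (P.map (fun ω => (U ω, X ω))).restrict (Set.univ ×ˢ Xr)ᶜ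
      = ((P.map U).prod (P.map X)).restrict (Set.univ ×ˢ Xr)ᶜ := by
    rw [hTc, ← Measure.prod_restrict, Measure.restrict_univ]
    refine (Measure.prod_eq fun S C hS hC => ?_).symm
    rw [Measure.restrict_apply (hS.prod hC), Measure.restrict_apply hC,
      Measure.map_apply hUXm ((hS.prod hC).inter (MeasurableSet.univ.prod hXr.compl)),
      Measure.map_apply hU hS, Measure.map_apply hX (hC.inter hXr.compl)]
    have h1 := key2 C hC S hS
    have h2 : (fun ω => (U ω, X ω)) ⁻¹' (S ×ˢ C ∩ Set.univ ×ˢ Xrᶜ)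
        = U ⁻¹' S ∩ (Eᶜ ∩ X ⁻¹' C) := by
      ext ω; simp [hE]; tauto
    have h3 : X ⁻¹' (C ∩ Xrᶜ) = Eᶜ ∩ X ⁻¹' C := by
      ext ω; simp [hE]; tauto
    rw [h2, h3]
    simp only [Measure.real] at h1
    rw [← ENNReal.toReal_mul] at h1
    exact (ENNReal.toReal_eq_toReal_iff' (measure_ne_top _ _)
      (ENNReal.mul_ne_top (measure_ne_top _ _) (measure_ne_top _ _))).mp h1
  rw [klDiv_eq_restrict hT hcompl]
  lift P E to NNReal using measure_ne_top P E with a ha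
  have ha0 : a ≠ 0 := by
    rintro rfl
    exact hE0 rfl
  have hcond : P[|E] = a⁻¹ • P.restrict E := by
    rw [ProbabilityTheory.cond, ← ha, ← ENNReal.coe_inv ha0]
    rfl
  have hL : (P[|E]).map (fun ω => (U ω, X ω))
      = a⁻¹ • (P.map (fun ω => (U ω, X ω))).restrict (Set.univ ×ˢ Xr) := by
    rw [hcond, Measure.map_smul, Measure.restrict_map hUXm hT]
    congr 3
    ext ω; simp [hE]
  have hR : (P.map U).prod ((P[|E]).map X)
      = a⁻¹ • ((P.map U).prod (P.map X)).restrict (Set.univ ×ˢ Xr) := by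
    rw [hcond, Measure.map_smul, ← Measure.prod_restrict, Measure.restrict_univ,
      Measure.restrict_map hX hXr]
    refine Measure.prod_eq fun S C hS hC => ?_
    simp only [Measure.smul_apply, Measure.prod_prod, ENNReal.smul_def, smul_eq_mul]
    ring
  rw [hL, hR, InformationTheory.klDiv_smul_same]
  have h5 : ((ENNReal.toReal (a : ENNReal) : ℝ) : EReal) = ((a : ENNReal) : EReal) :=
    EReal.coe_ennreal_toReal ENNReal.coe_ne_top
  rw [h5, ← EReal.coe_ennreal_mul, ← mul_assoc, ← ENNReal.coe_mul, mul_inv_cancel₀ ha0]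
  simp
end

section
/- Let k ≥ 2 be an integer and α ∈ (0,1). Let (X,Y) be a pair of discrete random variables such that X_r = {1,…,k} ⊆ X, P(X ∈ X_r) = α, X conditioned on {X ∈ X_r} is uniform on {1,…,k}, Y = X whenever X ∈ X_r, and the marginal law of Y is uniform on {1,…,k}. Then the hypercontractivity coefficient satisfies s(X;Y) ≥ log k / ( log k + log(1/α) ). -/
open MeasureTheory Real

/-- Kullback–Leibler divergence between two (sub-)probability mass functions on `ℕ`, valued in
the extended reals, with the conventions `0 log 0 = 0` and `D = ∞` if `q` is not absolutely
continuous with respect to `q'` (or if the defining series does not converge). -/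
noncomputable def DklN (q q' : ℕ → ℝ) : EReal :=
  open Classical in
  if (∀ x, q' x = 0 → q x = 0) ∧ Summable (fun x => q x * Real.log (q x / q' x)) then
    (((∑' x, q x * Real.log (q x / q' x)) : ℝ) : EReal)
  else ⊤

/-- The `X`-marginal of a joint pmf `p` on `ℕ × ℕ`. -/
noncomputable def margX (p : ℕ × ℕ → ℝ) (x : ℕ) : ℝ := ∑' y, p (x, y)

/-- The `Y`-marginal of a joint pmf `p` on `ℕ × ℕ`. -/
noncomputable def margY (p : ℕ × ℕ → ℝ) (y : ℕ) : ℝ := ∑' x, p (x, y)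

/-- The output pmf `r_Y(y) = Σ_x r(x) p(y|x)` where `p(y|x) = p(x,y)/p_X(x)`. -/
noncomputable def outPMF (p : ℕ × ℕ → ℝ) (r : ℕ → ℝ) (y : ℕ) : ℝ :=
  ∑' x, r x * (p (x, y) / margX p x)

/-- The hypercontractivity coefficient of a joint pmf `p` on `ℕ × ℕ`, in its
Kullback–Leibler-divergence characterization:
`s(X;Y) = sup { D(r_Y ‖ p_Y) / D(r ‖ p_X) : r a pmf with 0 < D(r ‖ p_X) < ∞ }`. -/
noncomputable def hcPMF (p : ℕ × ℕ → ℝ) : ℝ :=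
  sSup { t | ∃ r : ℕ → ℝ, (∀ x, 0 ≤ r x) ∧ HasSum r 1 ∧
    0 < DklN r (margX p) ∧ DklN r (margX p) < ⊤ ∧
    t = (DklN (outPMF p r) (margY p)).toReal / (DklN r (margX p)).toReal }

/-- Tangent-line inequality for `t log t`. -/
lemma hc_tangent (p w c : ℝ) (hp : 0 ≤ p) (hw : 0 ≤ w) (hc : 0 ≤ c) (h0 : c = 0 → p * w = 0) :
    p * w * Real.log c + p * w - c * p ≤ p * (w * Real.log w) := by
  rcases hc.eq_or_lt with h | h
  · have := h0 h.symm
    have h2 : p * (w * Real.log w) = 0 := by rw [← mul_assoc, this, zero_mul]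
    rw [h2, this, ← h]; simp
  rcases hw.eq_or_lt with h' | h'
  · rw [← h']; simp; positivity
  have h1 := Real.log_le_sub_one_of_pos (div_pos h h')
  rw [Real.log_div h.ne' h'.ne'] at h1
  have h2 : w * (Real.log c - Real.log w) ≤ w * (c / w - 1) := mul_le_mul_of_nonneg_left h1 hw
  have h3 : w * (c / w - 1) = c - w := by field_simp
  rw [h3] at h2
  have h4 := mul_le_mul_of_nonneg_left h2 hp
  nlinarith

/-- Data processing inequality (finite output alphabet). -/
lemma hc_dpi (p : ℕ × ℕ → ℝ) (hp : ∀ z, 0 ≤ p z) (hsx : ∀ x, Summable (fun y => p (x, y)))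
    (hsy : ∀ y, Summable (fun x => p (x, y))) (S : Finset ℕ)
    (hS0 : ∀ y, y ∉ S → ∀ x, p (x, y) = 0) (hS1 : ∀ y ∈ S, 0 < margY p y)
    (r : ℕ → ℝ) (hr : ∀ x, 0 ≤ r x) (hsr : Summable r) (hfin : DklN r (margX p) < ⊤) :
    (DklN (outPMF p r) (margY p)).toReal ≤ (DklN r (margX p)).toReal := by
  have hcond : (∀ x, margX p x = 0 → r x = 0) ∧
      Summable (fun x => r x * Real.log (r x / margX p x)) := by
    by_contra hcon
    rw [DklN, if_neg hcon] at hfin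
    exact lt_irrefl _ hfin
  obtain ⟨hac, hsum⟩ := hcond
  have hout0 : ∀ y, y ∉ S → outPMF p r y = 0 := by
    intro y hy
    simp [outPMF, hS0 y hy]
  have hmX : ∀ x, margX p x = ∑ y ∈ S, p (x, y) := fun x =>
    tsum_eq_sum (fun y hy => hS0 y hy x)
  have hmX0 : ∀ x, 0 ≤ margX p x := fun x => tsum_nonneg (fun y => hp _)
  have hle : ∀ x y, p (x, y) ≤ margX p x := fun x y =>
    (hsx x).le_tsum y (fun z _ => hp _)
  have hsw : ∀ y, Summable (fun x => r x * (p (x, y) / margX p x)) := by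
    intro y
    refine Summable.of_nonneg_of_le (fun x => mul_nonneg (hr x) (div_nonneg (hp _) (hmX0 x)))
      (fun x => ?_) hsr
    exact mul_le_of_le_one_right (hr x) (div_le_one_of_le₀ (hle x y) (hmX0 x))
  have hout_nn : ∀ y, 0 ≤ outPMF p r y := fun y =>
    tsum_nonneg (fun x => mul_nonneg (hr x) (div_nonneg (hp _) (hmX0 x)))
  have hHs : HasSum (fun x => ∑ y ∈ S,
      (r x * (p (x, y) / margX p x) * Real.log (outPMF p r y / margY p y)
        + r x * (p (x, y) / margX p x) - outPMF p r y / margY p y * p (x, y)))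
      (∑ y ∈ S, (outPMF p r y * Real.log (outPMF p r y / margY p y)
        + outPMF p r y - outPMF p r y / margY p y * margY p y)) := by
    refine hasSum_sum (fun y _ => ?_)
    exact (((hsw y).hasSum.mul_right _).add (hsw y).hasSum).sub ((hsy y).hasSum.mul_left _)
  have hpt : ∀ x, ∑ y ∈ S,
      (r x * (p (x, y) / margX p x) * Real.log (outPMF p r y / margY p y)
        + r x * (p (x, y) / margX p x) - outPMF p r y / margY p y * p (x, y))
      ≤ r x * Real.log (r x / margX p x) := by
    intro x
    have e : r x * Real.log (r x / margX p x)
        = ∑ y ∈ S, p (x, y) * (r x / margX p x * Real.log (r x / margX p x)) := by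
      rw [← Finset.sum_mul, ← hmX]
      by_cases h : margX p x = 0
      · simp [h]
      · field_simp
    rw [e]
    refine Finset.sum_le_sum (fun y hy => ?_)
    have e2 : r x * (p (x, y) / margX p x) = p (x, y) * (r x / margX p x) := by ring
    have := hc_tangent (p (x, y)) (r x / margX p x) (outPMF p r y / margY p y) (hp _)
      (div_nonneg (hr x) (hmX0 x)) (div_nonneg (hout_nn y) (hS1 y hy).le) ?_
    · rw [e2]; exact this
    · intro h
      have h' : outPMF p r y = 0 := by
        rcases div_eq_zero_iff.1 h with h | h
        · exact h
        · exact absurd h (hS1 y hy).ne'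
      rw [← e2]
      refine le_antisymm ?_ (mul_nonneg (hr x) (div_nonneg (hp _) (hmX0 x)))
      rw [← h']
      exact (hsw y).le_tsum x (fun z _ => mul_nonneg (hr z) (div_nonneg (hp _) (hmX0 z)))
  have hmain := hasSum_le hpt hHs hsum.hasSum
  have hX : DklN r (margX p) = ((∑' x, r x * Real.log (r x / margX p x) : ℝ) : EReal) := by
    rw [DklN, if_pos ⟨hac, hsum⟩]
  have hz : ∀ y, y ∉ S → outPMF p r y * Real.log (outPMF p r y / margY p y) = 0 := by
    intro y hy; simp [hout0 y hy]
  have hYeq : DklN (outPMF p r) (margY p)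
      = ((∑' y, outPMF p r y * Real.log (outPMF p r y / margY p y) : ℝ) : EReal) := by
    have hacY : ∀ y, margY p y = 0 → outPMF p r y = 0 := by
      intro y hy
      by_cases hyS : y ∈ S
      · exact absurd hy (hS1 y hyS).ne'
      · exact hout0 y hyS
    rw [DklN, if_pos ⟨hacY, summable_of_ne_finset_zero (s := S) (fun y hy => hz y hy)⟩]
  rw [hX, hYeq, EReal.toReal_coe, EReal.toReal_coe, tsum_eq_sum (s := S) (fun y hy => hz y hy)]
  refine le_trans (le_of_eq ?_) hmain
  refine Finset.sum_congr rfl (fun y hy => ?_)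
  rw [div_mul_cancel₀ _ (hS1 y hy).ne']; ring

lemma hc_hasSum {Ω : Type*} [MeasurableSpace Ω] (P : Measure Ω) [IsProbabilityMeasure P]
    (f : Ω → ℕ) (hf : Measurable f) (A : Set Ω) (hA : MeasurableSet A) :
    HasSum (fun n => (P (A ∩ {ω | f ω = n})).toReal) (P A).toReal := by
  have hm : ∀ n, MeasurableSet (A ∩ {ω | f ω = n}) := fun n =>
    hA.inter (hf (measurableSet_singleton n))
  have h : P A = ∑' n, P (A ∩ {ω | f ω = n}) := by
    rw [← measure_iUnion ?_ hm]
    · congr 1; ext ω; simp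
    · intro i j hij
      refine Set.disjoint_left.2 ?_
      rintro ω ⟨_, h1⟩ ⟨_, h2⟩
      exact hij (h1.symm.trans h2)
  have hne : ∑' n, P (A ∩ {ω | f ω = n}) ≠ ⊤ := h ▸ measure_ne_top P A
  rw [h, ENNReal.tsum_toReal_eq (fun n => measure_ne_top P _)]
  exact (ENNReal.summable_toReal hne).hasSum

/-- Divergence of a point mass at `1`. -/
lemma hc_point (q q' : ℕ → ℝ) (hq : ∀ x, q x = if x = 1 then 1 else 0) (h : q' 1 ≠ 0) :
    DklN q q' = ((Real.log (1 / q' 1) : ℝ) : EReal) := by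
  have hs : HasSum (fun x => q x * Real.log (q x / q' x)) (Real.log (1 / q' 1)) := by
    have := hasSum_single (f := fun x => q x * Real.log (q x / q' x)) 1
      (fun x hx => by simp [hq, hx])
    simpa [hq] using this
  have hac : ∀ x, q' x = 0 → q x = 0 := by
    intro x hx
    rw [hq, if_neg]
    rintro rfl
    exact h hx
  rw [DklN, if_pos ⟨hac, hs.summable⟩, hs.tsum_eq]

/-- **Discrete potential correlation (Example 2).** If `X_r = {1,…,k}` has probability `α`,
`X` restricted to `X_r` is uniform, `Y = X` on `{X ∈ X_r}`, and the marginal law of `Y` is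
uniform on `{1,…,k}`, then `s(X;Y) ≥ log k / (log k + log (1/α))`. -/
theorem hcPMF_ge_discrete {Ω : Type*} [MeasurableSpace Ω] (P : Measure Ω)
    [IsProbabilityMeasure P] (X Y : Ω → ℕ) (hX : Measurable X) (hY : Measurable Y)
    (k : ℕ) (hk : 2 ≤ k) (α : ℝ) (hα : α ∈ Set.Ioo (0 : ℝ) 1)
    (hXr : P {ω | 1 ≤ X ω ∧ X ω ≤ k} = ENNReal.ofReal α)
    (hunif : ∀ i, 1 ≤ i → i ≤ k → P {ω | X ω = i} = ENNReal.ofReal (α / k))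
    (hYX : ∀ ω, 1 ≤ X ω → X ω ≤ k → Y ω = X ω)
    (hYunif : ∀ j, P {ω | Y ω = j}
      = if 1 ≤ j ∧ j ≤ k then ENNReal.ofReal (1 / (k : ℝ)) else 0) :
    Real.log k / (Real.log k + Real.log (1 / α))
      ≤ hcPMF (fun z => (P {ω | X ω = z.1 ∧ Y ω = z.2}).toReal) := by
  set p : ℕ × ℕ → ℝ := fun z => (P {ω | X ω = z.1 ∧ Y ω = z.2}).toReal with hpdef
  obtain ⟨hα0, hα1⟩ := hα
  have hk0 : (0 : ℝ) < k := by positivity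
  have hx : ∀ x, HasSum (fun y => p (x, y)) (P {ω | X ω = x}).toReal := fun x =>
    hc_hasSum P Y hY {ω | X ω = x} (hX (measurableSet_singleton x))
  have hy : ∀ y, HasSum (fun x => p (x, y)) (P {ω | Y ω = y}).toReal := fun y => by
    have := hc_hasSum P X hX {ω | Y ω = y} (hY (measurableSet_singleton y))
    convert this using 4 with x
    ext ω; simp [and_comm]
  have hp : ∀ z, 0 ≤ p z := fun z => ENNReal.toReal_nonneg
  have hmX1 : margX p 1 = α / k := by
    rw [margX, (hx 1).tsum_eq, hunif 1 le_rfl (by omega), ENNReal.toReal_ofReal (by positivity)]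
  have hmY : ∀ y, 1 ≤ y → y ≤ k → margY p y = 1 / k := by
    intro y h1 h2
    rw [margY, (hy y).tsum_eq, hYunif y, if_pos ⟨h1, h2⟩, ENNReal.toReal_ofReal (by positivity)]
  have hS0 : ∀ y, y ∉ Finset.Icc 1 k → ∀ x, p (x, y) = 0 := by
    intro y hyS x
    have h0 : P {ω | Y ω = y} = 0 := by
      rw [hYunif y, if_neg (by simpa using hyS)]
    have : P {ω | X ω = x ∧ Y ω = y} = 0 := measure_mono_null (fun ω h => h.2) h0
    simp [hpdef, this]
  have hS1 : ∀ y ∈ Finset.Icc 1 k, 0 < margY p y := by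
    intro y h
    rw [Finset.mem_Icc] at h
    rw [hmY y h.1 h.2]; positivity
  have hbdd : BddAbove { t | ∃ r : ℕ → ℝ, (∀ x, 0 ≤ r x) ∧ HasSum r 1 ∧
    0 < DklN r (margX p) ∧ DklN r (margX p) < ⊤ ∧
    t = (DklN (outPMF p r) (margY p)).toReal / (DklN r (margX p)).toReal } := by
    refine ⟨1, ?_⟩
    rintro t ⟨r, hr, hr1, hpos, hfin, rfl⟩
    refine div_le_one_of_le₀ ?_ (EReal.toReal_nonneg hpos.le)
    exact hc_dpi p hp (fun x => (hx x).summable) (fun y => (hy y).summable) _ hS0 hS1 r hr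
      hr1.summable hfin
  have hlogk : 0 < Real.log k := Real.log_pos (by exact_mod_cast hk)
  have hlogα : 0 < Real.log (1 / α) := Real.log_pos (by rw [lt_div_iff₀ hα0]; linarith)
  have hak : α / k ≠ 0 := by positivity
  have hp1 : ∀ y, p (1, y) = if y = 1 then α / k else 0 := by
    intro y
    split_ifs with h
    · subst h
      have : {ω | X ω = 1 ∧ Y ω = 1} = {ω | X ω = 1} := by
        ext ω
        refine ⟨fun h => h.1, fun h => ⟨h, ?_⟩⟩
        have h' : X ω = 1 := h
        rw [hYX ω (by omega) (by omega), h']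
      simp only [hpdef]
      rw [this, hunif 1 le_rfl (by omega), ENNReal.toReal_ofReal (by positivity)]
    · have : {ω | X ω = 1 ∧ Y ω = y} = ∅ := by
        ext ω
        simp only [Set.mem_ofPred_eq, Set.mem_empty_iff_false, iff_false]
        rintro ⟨h1, h2⟩
        have := hYX ω (by omega) (by omega)
        omega
      simp only [hpdef]
      rw [this]; simp
  let r : ℕ → ℝ := fun x => if x = 1 then 1 else 0
  have hout : ∀ y, outPMF p r y = if y = 1 then 1 else 0 := by
    intro y
    rw [outPMF, tsum_eq_single 1 (fun x hx => by simp [r, hx]), hmX1, hp1]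
    split_ifs with h
    · simp [r, div_self hak]
    · simp
  have hD1 : DklN r (margX p) = ((Real.log k + Real.log (1 / α) : ℝ) : EReal) := by
    rw [hc_point r (margX p) (fun x => rfl) (by rw [hmX1]; exact hak), hmX1,
      ← Real.log_mul hk0.ne' (by positivity)]
    congr 2; field_simp
  have hD2 : DklN (outPMF p r) (margY p) = ((Real.log k : ℝ) : EReal) := by
    have h1 := hmY 1 le_rfl (by omega)
    rw [hc_point _ (margY p) hout (by rw [h1]; positivity), h1, one_div_one_div]
  refine le_csSup hbdd ⟨r, ?_, ?_, ?_, ?_, ?_⟩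
  · intro x; simp only [r]; split_ifs <;> norm_num
  · exact hasSum_ite_eq 1 1
  · rw [hD1]; exact_mod_cast add_pos hlogk hlogα
  · rw [hD1]; exact EReal.coe_lt_top _
  · rw [hD1, hD2, EReal.toReal_coe, EReal.toReal_coe]
end

section
/- Let k ≥ 2 be an integer, α ∈ (0,1), and ε ∈ (0, (k−1)/k). Let (X,Y) be a pair of discrete random variables such that X_r = {1,…,k} ⊆ X, P(X ∈ X_r) = α, X conditioned on {X ∈ X_r} is uniform on {1,…,k}, the conditional distribution of Y given X = x for x ∈ X_r is P(Y = x) = 1 − ε and P(Y = j) = ε/(k−1) for each j ∈ {1,…,k}, j ≠ x, and the marginal law of Y is uniform on {1,…,k}. Then the hypercontractivity coefficient satisfies s(X;Y) ≥ ( log k − H₂(ε) − ε log(k−1) ) / log(k/α), where H₂(ε) = −ε log ε − (1−ε) log(1−ε) is the binary entropy function. -/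
open MeasureTheory Real

/-- The binary entropy function `H₂(ε) = -ε log ε - (1-ε) log (1-ε)`. -/
noncomputable def binEnt (a : ℝ) : ℝ := -a * Real.log a - (1 - a) * Real.log (1 - a)


lemma dkl_pt (a b c l : ℝ) (ha : 0 ≤ a) (hb : 0 ≤ b) (hc : 0 < c)
    (h : 0 < a → 0 < b ∧ l = Real.log (a / b)) :
    a * Real.log c + a - b * c ≤ a * l := by
  rcases ha.eq_or_lt with rfl | ha
  · simp; positivity
  · obtain ⟨hb, rfl⟩ := h ha
    have h1 := Real.log_le_sub_one_of_pos (show 0 < c / (a / b) by positivity)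
    rw [Real.log_div hc.ne' (by positivity)] at h1
    have h2 := mul_le_mul_of_nonneg_left h1 ha.le
    have h3 : a * (c / (a / b) - 1) = b * c - a := by field_simp
    nlinarith

lemma dpi_aux (p : ℕ × ℕ → ℝ) (h0 : ∀ z, 0 ≤ p z) (S : Finset ℕ)
    (hS : ∀ x y, y ∉ S → p (x, y) = 0) (hpos : ∀ y ∈ S, 0 < margY p y)
    (r : ℕ → ℝ) (hr : ∀ x, 0 ≤ r x) (hr1 : HasSum r 1)
    (hac : ∀ x, margX p x = 0 → r x = 0)
    (hsum : Summable (fun x => r x * Real.log (r x / margX p x))) :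
    ∑ y ∈ S, outPMF p r y * Real.log (outPMF p r y / margY p y)
      ≤ ∑' x, r x * Real.log (r x / margX p x) := by
  have hmX : ∀ x, margX p x = ∑ y ∈ S, p (x, y) := fun x =>
    tsum_eq_sum (fun y hy => hS x y hy)
  have hmX0 : ∀ x, 0 ≤ margX p x := fun x => by
    rw [hmX]; exact Finset.sum_nonneg fun y _ => h0 _
  have hle : ∀ x, ∀ y ∈ S, p (x, y) ≤ margX p x := fun x y hy => by
    rw [hmX]; exact Finset.single_le_sum (f := fun y => p (x, y)) (fun y _ => h0 _) hy
  have hq0 : ∀ x y, 0 ≤ p (x, y) / margX p x := fun x y => div_nonneg (h0 _) (hmX0 x)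
  have hq1 : ∀ x, ∀ y ∈ S, p (x, y) / margX p x ≤ 1 := fun x y hy =>
    div_le_one_of_le₀ (hle x y hy) (hmX0 x)
  have hsA : ∀ y ∈ S, Summable (fun x => r x * (p (x, y) / margX p x)) := fun y hy =>
    Summable.of_nonneg_of_le (fun x => mul_nonneg (hr x) (hq0 x y))
      (fun x => mul_le_of_le_one_right (hr x) (hq1 x y hy)) hr1.summable
  have hsB : ∀ y ∈ S, Summable (fun x => p (x, y)) := fun y hy => by
    by_contra hn
    exact (hpos y hy).ne' (tsum_eq_zero_of_not_summable hn)
  have hsL : ∀ y ∈ S, Summable (fun x =>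
      (r x * (p (x, y) / margX p x)) * Real.log (r x / margX p x)) := fun y hy => by
    refine Summable.of_norm_bounded hsum.norm (fun x => ?_)
    have : (r x * (p (x, y) / margX p x)) * Real.log (r x / margX p x)
      = (p (x, y) / margX p x) * (r x * Real.log (r x / margX p x)) := by ring
    rw [this, norm_mul, Real.norm_of_nonneg (hq0 x y)]
    exact mul_le_of_le_one_left (norm_nonneg _) (hq1 x y hy)
  have key : ∀ y ∈ S, outPMF p r y * Real.log (outPMF p r y / margY p y)
      ≤ ∑' x, (r x * (p (x, y) / margX p x)) * Real.log (r x / margX p x) := by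
    intro y hy
    have hA0 : 0 ≤ outPMF p r y := tsum_nonneg fun x => mul_nonneg (hr x) (hq0 x y)
    rcases hA0.eq_or_lt with hA | hA
    · have hz := (hasSum_zero_iff_of_nonneg
        (fun x => mul_nonneg (hr x) (hq0 x y))).1 (by
          have := (hsA y hy).hasSum
          rwa [show (∑' x, r x * (p (x, y) / margX p x)) = 0 from hA.symm] at this)
      have hz' : ∀ x, r x * (p (x, y) / margX p x) = 0 := fun x => congrFun hz x
      simp [← hA, hz']
    · have hB := hpos y hy
      set c := outPMF p r y / margY p y with hc
      have hcpos : 0 < c := div_pos hA hB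
      have hs1 : HasSum (fun x => (r x * (p (x, y) / margX p x)) * Real.log c
          + r x * (p (x, y) / margX p x) - p (x, y) * c)
          (outPMF p r y * Real.log c + outPMF p r y - margY p y * c) :=
        (((hsA y hy).hasSum.mul_right _).add (hsA y hy).hasSum).sub
          ((hsB y hy).hasSum.mul_right c)
      have h2 : margY p y * c = outPMF p r y := by rw [hc]; field_simp
      rw [h2, add_sub_cancel_right] at hs1
      refine hasSum_le (fun x => ?_) hs1 (hsL y hy).hasSum
      refine dkl_pt _ _ _ _ (mul_nonneg (hr x) (hq0 x y)) (h0 _) hcpos (fun ha => ?_)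
      have hp : p (x, y) ≠ 0 := by rintro h; simp [h] at ha
      have hm : margX p x ≠ 0 := by rintro h; simp [h] at ha
      refine ⟨lt_of_le_of_ne (h0 _) hp.symm, ?_⟩
      congr 1
      field_simp
  refine (Finset.sum_le_sum key).trans (le_of_eq ?_)
  rw [← Summable.tsum_finsetSum hsL]
  refine tsum_congr fun x => ?_
  by_cases hm : margX p x = 0
  · simp [hac x hm]
  · rw [← Finset.sum_mul, ← Finset.mul_sum, ← Finset.sum_div, ← hmX, div_self hm, mul_one]

lemma DklN_out (p : ℕ × ℕ → ℝ) (S : Finset ℕ)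
    (hS : ∀ x y, y ∉ S → p (x, y) = 0) (hpos : ∀ y ∈ S, 0 < margY p y) (r : ℕ → ℝ) :
    DklN (outPMF p r) (margY p) =
      ((∑ y ∈ S, outPMF p r y * Real.log (outPMF p r y / margY p y) : ℝ) : EReal) := by
  have ho : ∀ y ∉ S, outPMF p r y = 0 := fun y hy => by simp [outPMF, hS _ y hy]
  have hz : ∀ y ∉ S, outPMF p r y * Real.log (outPMF p r y / margY p y) = 0 :=
    fun y hy => by simp [ho y hy]
  have hac : ∀ y, margY p y = 0 → outPMF p r y = 0 := by
    intro y hy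
    by_cases hyS : y ∈ S
    · exact absurd hy (hpos y hyS).ne'
    · exact ho y hyS
  rw [DklN, if_pos ⟨hac, summable_of_ne_finset_zero hz⟩, tsum_eq_sum hz]

lemma hc_bdd (p : ℕ × ℕ → ℝ) (h0 : ∀ z, 0 ≤ p z) (S : Finset ℕ)
    (hS : ∀ x y, y ∉ S → p (x, y) = 0) (hpos : ∀ y ∈ S, 0 < margY p y) :
    BddAbove { t | ∃ r : ℕ → ℝ, (∀ x, 0 ≤ r x) ∧ HasSum r 1 ∧
    0 < DklN r (margX p) ∧ DklN r (margX p) < ⊤ ∧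
    t = (DklN (outPMF p r) (margY p)).toReal / (DklN r (margX p)).toReal } := by
  refine ⟨1, ?_⟩
  rintro t ⟨r, hr, hr1, hD0, hDt, rfl⟩
  have hcond : (∀ x, margX p x = 0 → r x = 0) ∧
      Summable (fun x => r x * Real.log (r x / margX p x)) := by
    by_contra h
    rw [DklN, if_neg h] at hDt
    exact lt_irrefl _ hDt
  rw [DklN_out p S hS hpos]
  rw [DklN, if_pos hcond] at hD0 ⊢
  rw [EReal.toReal_coe, EReal.toReal_coe]
  have hD0' := EReal.coe_pos.1 hD0
  exact (div_le_one hD0').2 (dpi_aux p h0 S hS hpos r hr hr1 hcond.1 hcond.2)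

/-- **Noisy discrete potential correlation (Example 3).** If `X_r = {1,…,k}` has probability
`α`, `X` restricted to `X_r` is uniform, `Y` given `X = x ∈ X_r` is the output of the symmetric
channel with crossover `ε`, and the marginal law of `Y` is uniform on `{1,…,k}`, then
`s(X;Y) ≥ (log k − H₂(ε) − ε log(k−1)) / log(k/α)`. -/
theorem hcPMF_ge_noisy_discrete {Ω : Type*} [MeasurableSpace Ω] (P : Measure Ω)
    [IsProbabilityMeasure P] (X Y : Ω → ℕ) (hX : Measurable X) (hY : Measurable Y)
    (k : ℕ) (hk : 2 ≤ k) (α : ℝ) (hα : α ∈ Set.Ioo (0 : ℝ) 1)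
    (ε : ℝ) (hε : ε ∈ Set.Ioo (0 : ℝ) (((k : ℝ) - 1) / k))
    (hXr : P {ω | 1 ≤ X ω ∧ X ω ≤ k} = ENNReal.ofReal α)
    (hunif : ∀ i, 1 ≤ i → i ≤ k → P {ω | X ω = i} = ENNReal.ofReal (α / k))
    (hchan : ∀ i j, 1 ≤ i → i ≤ k → 1 ≤ j → j ≤ k →
      P {ω | X ω = i ∧ Y ω = j}
        = ENNReal.ofReal ((α / k) * (if j = i then 1 - ε else ε / ((k : ℝ) - 1))))
    (hYunif : ∀ j, P {ω | Y ω = j}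
      = if 1 ≤ j ∧ j ≤ k then ENNReal.ofReal (1 / (k : ℝ)) else 0) :
    (Real.log k - binEnt ε - ε * Real.log ((k : ℝ) - 1)) / Real.log ((k : ℝ) / α)
      ≤ hcPMF (fun z => (P {ω | X ω = z.1 ∧ Y ω = z.2}).toReal) := by
  obtain ⟨hα0, hα1⟩ := hα
  obtain ⟨hε0, hε1⟩ := hε
  have hk2 : (2 : ℝ) ≤ k := by exact_mod_cast hk
  have hk0 : (0 : ℝ) < k := by linarith
  have hk1 : (0 : ℝ) < (k : ℝ) - 1 := by linarith
  have hε1' : 0 < 1 - ε := by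
    have : ((k : ℝ) - 1) / k < 1 := by rw [div_lt_one hk0]; linarith
    linarith
  set p : ℕ × ℕ → ℝ := fun z => (P {ω | X ω = z.1 ∧ Y ω = z.2}).toReal with hp
  set S : Finset ℕ := Finset.Icc 1 k with hSdef
  have h0 : ∀ z, 0 ≤ p z := fun z => ENNReal.toReal_nonneg
  have hmY : ∀ y, margY p y = (P {ω | Y ω = y}).toReal := by
    intro y
    have hU : {ω | Y ω = y} = ⋃ x, {ω | X ω = x ∧ Y ω = y} := by ext ω; simp
    rw [hU, measure_iUnion]
    · rw [ENNReal.tsum_toReal_eq (fun x => measure_ne_top _ _)]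
      rfl
    · intro a b hab
      refine Set.disjoint_left.2 ?_
      rintro ω ⟨h1, _⟩ ⟨h2, _⟩
      exact hab (h1.symm.trans h2)
    · intro x
      exact (hX (measurableSet_singleton x)).inter (hY (measurableSet_singleton y))
  have hmYS : ∀ y ∈ S, margY p y = 1 / k := by
    intro y hy
    rw [hmY, hYunif, if_pos (Finset.mem_Icc.1 hy), ENNReal.toReal_ofReal (by positivity)]
  have hS : ∀ x y, y ∉ S → p (x, y) = 0 := by
    intro x y hy
    have h1 : P {ω | Y ω = y} = 0 := by
      rw [hYunif, if_neg (fun h => hy (Finset.mem_Icc.2 h))]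
    have h2 : P {ω | X ω = x ∧ Y ω = y} = 0 := measure_mono_null (fun ω h => h.2) h1
    simp [hp, h2]
  have hpos : ∀ y ∈ S, 0 < margY p y := fun y hy => by rw [hmYS y hy]; positivity
  have h1S : 1 ∈ S := Finset.mem_Icc.2 ⟨le_rfl, by omega⟩
  have hp1 : ∀ y ∈ S, p (1, y) = (α / k) * (if y = 1 then 1 - ε else ε / ((k : ℝ) - 1)) := by
    intro y hy
    obtain ⟨hy1, hy2⟩ := Finset.mem_Icc.1 hy
    have := hchan 1 y le_rfl (by omega) hy1 hy2
    simp only [hp]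
    rw [this, ENNReal.toReal_ofReal]
    split_ifs <;> positivity
  have hcard : ((S.erase 1).card : ℝ) = (k : ℝ) - 1 := by
    rw [Finset.card_erase_of_mem h1S, hSdef, Nat.card_Icc]
    simp [Nat.cast_sub (show 1 ≤ k by omega)]
  have hsumS : ∀ f : ℝ → ℝ, ∑ y ∈ S, f (if y = 1 then 1 - ε else ε / ((k : ℝ) - 1))
      = f (1 - ε) + ((k : ℝ) - 1) * f (ε / ((k : ℝ) - 1)) := by
    intro f
    rw [← Finset.add_sum_erase S _ h1S, if_pos rfl, ← hcard, ← nsmul_eq_mul, ← Finset.sum_const]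
    congr 1
    refine Finset.sum_congr rfl fun y hy => ?_
    rw [if_neg (Finset.ne_of_mem_erase hy)]
  have hmX1 : margX p 1 = α / k := by
    rw [margX, tsum_eq_sum (s := S) (fun y hy => hS 1 y hy), Finset.sum_congr rfl hp1,
      hsumS (fun t => α / k * t)]
    field_simp
    ring
  set r : ℕ → ℝ := fun x => if x = 1 then 1 else 0 with hr
  have hout : ∀ y ∈ S, outPMF p r y = if y = 1 then 1 - ε else ε / ((k : ℝ) - 1) := by
    intro y hy
    rw [outPMF, tsum_eq_single 1 (fun x hx => by simp [hr, hx]), hmX1, hp1 y hy]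
    have : α / k ≠ 0 := by positivity
    simp only [hr, if_true, one_mul]
    field_simp
  have hDr : DklN r (margX p) = ((Real.log (k / α) : ℝ) : EReal) := by
    have hz : ∀ x, x ≠ 1 → r x * Real.log (r x / margX p x) = 0 := fun x hx => by simp [hr, hx]
    have hac : ∀ x, margX p x = 0 → r x = 0 := by
      intro x hx
      by_cases h : x = 1
      · subst h
        rw [hmX1] at hx
        exact absurd hx (by positivity)
      · simp [hr, h]
    rw [DklN, if_pos ⟨hac, summable_of_ne_finset_zero (s := {1})
      (fun x hx => hz x (by simpa using hx))⟩, tsum_eq_single 1 hz, hmX1]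
    simp [hr]
  have hlog : 0 < Real.log (k / α) := Real.log_pos (by rw [lt_div_iff₀ hα0]; linarith)
  refine le_csSup (hc_bdd p h0 S hS hpos) ⟨r, fun x => ?_, ?_, ?_, ?_, ?_⟩
  · simp only [hr]; split_ifs <;> norm_num
  · exact hasSum_ite_eq 1 1
  · rw [hDr]; exact EReal.coe_pos.2 hlog
  · rw [hDr]; exact EReal.coe_lt_top _
  · rw [hDr, DklN_out p S hS hpos, EReal.toReal_coe, EReal.toReal_coe]
    congr 1
    have : ∑ y ∈ S, outPMF p r y * Real.log (outPMF p r y / margY p y)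
        = ∑ y ∈ S, (fun t : ℝ => t * Real.log (t / (1 / k)))
          (if y = 1 then 1 - ε else ε / ((k : ℝ) - 1)) :=
      Finset.sum_congr rfl fun y hy => by rw [hout y hy, hmYS y hy]
    rw [this, hsumS (fun t : ℝ => t * Real.log (t / (1 / k)))]
    simp only [div_div_eq_mul_div, div_one]
    rw [Real.log_mul hε1'.ne' hk0.ne', Real.log_mul (div_pos hε0 hk1).ne' hk0.ne',
      Real.log_div hε0.ne' hk1.ne', binEnt]
    field_simp
    ring
end

section
/- Let k ≥ 2 be an integer and ε ∈ [0, (k−1)/k]. Let X be uniformly distributed on {1,…,k} and let Y be the output of the symmetric channel with input X: P(Y = x | X = x) = 1 − ε and P(Y = j | X = x) = ε/(k−1) for each j ≠ x. Then the HGR maximal correlation satisfies mCor(X,Y) = 1 − kε/(k−1). -/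
open MeasureTheory Real

/-- The Hirschfeld–Gebelein–Rényi maximal correlation of discrete (ℕ-valued) random variables
`X`, `Y`: `mCor(X,Y) = sup E[f(X) g(Y)]` over `f, g : ℕ → ℝ` with `E[f(X)] = E[g(Y)] = 0`,
`E[f(X)²] ≤ 1` and `E[g(Y)²] ≤ 1`. -/
noncomputable def mCorD {Ω : Type*} [MeasurableSpace Ω] (P : Measure Ω) (X Y : Ω → ℕ) : ℝ :=
  sSup { t | ∃ f g : ℕ → ℝ,
    Integrable (fun ω => f (X ω)) P ∧ Integrable (fun ω => g (Y ω)) P ∧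
    Integrable (fun ω => (f (X ω)) ^ 2) P ∧ Integrable (fun ω => (g (Y ω)) ^ 2) P ∧
    (∫ ω, f (X ω) ∂P) = 0 ∧ (∫ ω, g (Y ω) ∂P) = 0 ∧
    (∫ ω, (f (X ω)) ^ 2 ∂P) ≤ 1 ∧ (∫ ω, (g (Y ω)) ^ 2 ∂P) ≤ 1 ∧
    t = ∫ ω, f (X ω) * g (Y ω) ∂P }

/-- Expectations of functions of `(X, Y)` as finite sums. -/
lemma key_expect {Ω : Type*} [MeasurableSpace Ω] (P : Measure Ω)
    [IsProbabilityMeasure P] (X Y : Ω → ℕ) (hX : Measurable X) (hY : Measurable Y)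
    (k : ℕ) (hk : 2 ≤ k) (ε : ℝ) (hε : ε ∈ Set.Icc (0 : ℝ) (((k : ℝ) - 1) / k))
    (hjoint : ∀ i j, P {ω | X ω = i ∧ Y ω = j}
      = if (1 ≤ i ∧ i ≤ k) ∧ (1 ≤ j ∧ j ≤ k) then
          ENNReal.ofReal ((1 / (k : ℝ)) * (if j = i then 1 - ε else ε / ((k : ℝ) - 1)))
        else 0) (h : ℕ → ℕ → ℝ) :
    Integrable (fun ω => h (X ω) (Y ω)) P ∧
    ∫ ω, h (X ω) (Y ω) ∂P = (1 / (k : ℝ)) * (ε / ((k : ℝ) - 1) *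
        ∑ i ∈ Finset.Icc 1 k, ∑ j ∈ Finset.Icc 1 k, h i j
      + (1 - (k : ℝ) * ε / ((k : ℝ) - 1)) * ∑ i ∈ Finset.Icc 1 k, h i i) := by
  have hk' : (2 : ℝ) ≤ k := by exact_mod_cast hk
  have hk1 : (0 : ℝ) < (k : ℝ) - 1 := by linarith
  have hk0 : (0 : ℝ) < (k : ℝ) := by linarith
  obtain ⟨h0, h1⟩ := hε
  have h1' : ε ≤ 1 := h1.trans (by rw [div_le_one hk0]; linarith)
  set Z : Ω → ℕ × ℕ := fun ω => (X ω, Y ω) with hZ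
  have hZm : Measurable Z := hX.prodMk hY
  set S : Finset (ℕ × ℕ) := Finset.Icc 1 k ×ˢ Finset.Icc 1 k with hS
  set μ := P.map Z with hμ
  have hμs : ∀ z : ℕ × ℕ, μ {z} = P {ω | X ω = z.1 ∧ Y ω = z.2} := by
    intro z
    rw [hμ, Measure.map_apply hZm (measurableSet_singleton z)]
    congr 1
    ext ω
    simp [hZ, Prod.ext_iff]
  have hae : ∀ᵐ z ∂μ, z ∈ (S : Set (ℕ × ℕ)) := by
    rw [ae_iff, ← Set.biUnion_of_singleton {a | a ∉ (S : Set (ℕ × ℕ))},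
      measure_biUnion_null_iff (Set.to_countable _)]
    intro z hz
    rw [hμs, hjoint, if_neg]
    intro hc
    apply hz
    simp only [hS, Finset.mem_coe, Finset.mem_product, Finset.mem_Icc]
    exact hc
  have hres : μ.restrict (S : Set (ℕ × ℕ)) = μ := Measure.restrict_eq_self_of_ae_mem hae
  have hfin : IsFiniteMeasure μ := by rw [hμ]; infer_instance
  have hint : IntegrableOn (fun z : ℕ × ℕ => h z.1 z.2) (S : Set (ℕ × ℕ)) μ :=
    IntegrableOn.finset
  have hint2 : Integrable (fun z : ℕ × ℕ => h z.1 z.2) μ := by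
    rw [IntegrableOn, hres] at hint
    exact hint
  refine ⟨hint2.comp_measurable hZm, ?_⟩
  have e1 : ∫ ω, h (X ω) (Y ω) ∂P = ∫ z, h z.1 z.2 ∂μ := by
    rw [hμ, integral_map hZm.aemeasurable]
    exact hint2.aestronglyMeasurable
  rw [e1, ← hres, setIntegral_finset (hf := hint), hS, Finset.sum_product, Finset.mul_sum,
    Finset.mul_sum, ← Finset.sum_add_distrib, Finset.mul_sum]
  refine Finset.sum_congr rfl fun i hi => ?_
  have hd : h i i = ∑ j ∈ Finset.Icc 1 k, if j = i then h i j else 0 := by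
    rw [Finset.sum_ite_eq' , if_pos hi]
  rw [hd, Finset.mul_sum, Finset.mul_sum, ← Finset.sum_add_distrib, Finset.mul_sum]
  refine Finset.sum_congr rfl fun j hj => ?_
  rw [measureReal_def, hμs, hjoint, if_pos ⟨Finset.mem_Icc.1 hi, Finset.mem_Icc.1 hj⟩]
  have hpos : 0 ≤ (1 / (k : ℝ)) * (if j = i then 1 - ε else ε / ((k : ℝ) - 1)) := by
    apply mul_nonneg (by positivity)
    split_ifs
    · linarith
    · positivity
  rw [ENNReal.toReal_ofReal hpos, smul_eq_mul]
  split_ifs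
  · field_simp
    ring
  · ring

/-- **Maximal correlation of the symmetric channel.** If `X` is uniform on `{1,…,k}` and `Y` is
the output of the symmetric channel with crossover probability `ε` on input `X`, then
`mCor(X,Y) = 1 − kε/(k−1)`. -/
theorem mCor_symmetric_channel {Ω : Type*} [MeasurableSpace Ω] (P : Measure Ω)
    [IsProbabilityMeasure P] (X Y : Ω → ℕ) (hX : Measurable X) (hY : Measurable Y)
    (k : ℕ) (hk : 2 ≤ k) (ε : ℝ) (hε : ε ∈ Set.Icc (0 : ℝ) (((k : ℝ) - 1) / k))
    (hXunif : ∀ i, P {ω | X ω = i}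
      = if 1 ≤ i ∧ i ≤ k then ENNReal.ofReal (1 / (k : ℝ)) else 0)
    (hjoint : ∀ i j, P {ω | X ω = i ∧ Y ω = j}
      = if (1 ≤ i ∧ i ≤ k) ∧ (1 ≤ j ∧ j ≤ k) then
          ENNReal.ofReal ((1 / (k : ℝ)) * (if j = i then 1 - ε else ε / ((k : ℝ) - 1)))
        else 0) :
    mCorD P X Y = 1 - (k : ℝ) * ε / ((k : ℝ) - 1) := by
  have hk' : (2 : ℝ) ≤ k := by exact_mod_cast hk
  have hk1 : (0 : ℝ) < (k : ℝ) - 1 := by linarith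
  have hk0 : (0 : ℝ) < (k : ℝ) := by linarith
  have K := key_expect P X Y hX hY k hk ε hε hjoint
  have hρ : 0 ≤ 1 - (k : ℝ) * ε / ((k : ℝ) - 1) := by
    have := hε.2
    rw [le_div_iff₀ hk0] at this
    rw [sub_nonneg, div_le_one hk1]
    linarith
  have KX : ∀ f : ℕ → ℝ, Integrable (fun ω => f (X ω)) P ∧
      ∫ ω, f (X ω) ∂P = (1 / (k : ℝ)) * ∑ i ∈ Finset.Icc 1 k, f i := by
    intro f
    obtain ⟨a, b⟩ := K (fun i _ => f i)
    refine ⟨a, b.trans ?_⟩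
    simp only [Finset.sum_const, Nat.card_Icc, add_tsub_cancel_right, nsmul_eq_mul,
      ← Finset.mul_sum]
    field_simp
    ring
  have KY : ∀ f : ℕ → ℝ, Integrable (fun ω => f (Y ω)) P ∧
      ∫ ω, f (Y ω) ∂P = (1 / (k : ℝ)) * ∑ i ∈ Finset.Icc 1 k, f i := by
    intro f
    obtain ⟨a, b⟩ := K (fun _ j => f j)
    refine ⟨a, b.trans ?_⟩
    simp only [Finset.sum_const, Nat.card_Icc, add_tsub_cancel_right, nsmul_eq_mul]
    field_simp
    ring
  have KXY : ∀ f g : ℕ → ℝ, ∑ i ∈ Finset.Icc 1 k, f i = 0 →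
      ∫ ω, f (X ω) * g (Y ω) ∂P = (1 - (k : ℝ) * ε / ((k : ℝ) - 1)) *
        ((1 / (k : ℝ)) * ∑ i ∈ Finset.Icc 1 k, f i * g i) := by
    intro f g hf
    rw [(K (fun i j => f i * g j)).2, ← Finset.sum_mul_sum, hf]
    ring
  unfold mCorD
  refine IsGreatest.csSup_eq ⟨?_, ?_⟩
  · set c := √((k : ℝ) / 2) with hc
    have hc2 : c ^ 2 = k / 2 := Real.sq_sqrt (by positivity)
    let f : ℕ → ℝ := fun i => (if i = 1 then c else 0) - (if i = 2 then c else 0)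
    have m1 : 1 ∈ Finset.Icc 1 k := by simp; omega
    have m2 : 2 ∈ Finset.Icc 1 k := by simp; omega
    have s1 : ∑ i ∈ Finset.Icc 1 k, f i = 0 := by
      simp only [f]
      rw [Finset.sum_sub_distrib, Finset.sum_ite_eq', Finset.sum_ite_eq', if_pos m1, if_pos m2,
        sub_self]
    have s2 : ∑ i ∈ Finset.Icc 1 k, f i ^ 2 = k := by
      have : ∀ i, f i ^ 2 = (if i = 1 then (k : ℝ) / 2 else 0)
          + (if i = 2 then (k : ℝ) / 2 else 0) := by
        intro i
        simp only [f]
        by_cases a : i = 1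
        · simp [a, hc2]
        · by_cases b : i = 2
          · simp [b, hc2]
          · simp [a, b]
      simp only [this]
      rw [Finset.sum_add_distrib, Finset.sum_ite_eq', Finset.sum_ite_eq', if_pos m1, if_pos m2]
      ring
    refine ⟨f, f, (KX f).1, (KY f).1, (KX (fun i => f i ^ 2)).1, (KY (fun i => f i ^ 2)).1,
      ?_, ?_, ?_, ?_, ?_⟩
    · rw [(KX f).2, s1, mul_zero]
    · rw [(KY f).2, s1, mul_zero]
    · rw [(KX (fun i => f i ^ 2)).2, s2]
      exact (one_div_mul_cancel hk0.ne').le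
    · rw [(KY (fun i => f i ^ 2)).2, s2]
      exact (one_div_mul_cancel hk0.ne').le
    · rw [KXY f f s1]
      simp only [← pow_two]
      rw [s2, one_div_mul_cancel hk0.ne', mul_one]
  · rintro t ⟨f, g, -, -, -, -, hf, -, hf2, hg2, rfl⟩
    rw [(KX f).2] at hf
    rw [(KX (fun i => f i ^ 2)).2] at hf2
    rw [(KY (fun i => g i ^ 2)).2] at hg2
    have hf0 : ∑ i ∈ Finset.Icc 1 k, f i = 0 := by
      rcases mul_eq_zero.1 hf with h | h
      · exact absurd h (by positivity)
      · exact h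
    rw [KXY f g hf0]
    refine mul_le_of_le_one_right hρ ?_
    have hle : ∑ i ∈ Finset.Icc 1 k, f i * g i ≤
        ((∑ i ∈ Finset.Icc 1 k, f i ^ 2) + ∑ i ∈ Finset.Icc 1 k, g i ^ 2) / 2 := by
      rw [← Finset.sum_add_distrib, Finset.sum_div]
      refine Finset.sum_le_sum fun i _ => ?_
      nlinarith [sq_nonneg (f i - g i)]
    have := mul_le_mul_of_nonneg_left hle (by positivity : 0 ≤ 1 / (k : ℝ))
    linarith
end

section
/- Let k ≥ 2 be an integer, α ∈ (0,1), and ε ∈ [0, (k−1)/k]. Let (X,Y) be a pair of discrete random variables such that X_r = {1,…,k} ⊆ X, P(X ∈ X_r) = α, X conditioned on {X ∈ X_r} is uniform on {1,…,k}, the conditional distribution of Y given X = x for x ∈ X_r is P(Y = x) = 1 − ε and P(Y = j) = ε/(k−1) for each j ∈ {1,…,k}, j ≠ x, Y is independent of X conditioned on {X ∉ X_r}, and the conditional law of Y given {X ∉ X_r} equals the conditional law of Y given {X ∈ X_r} (the uniform distribution on {1,…,k}). Then the HGR maximal correlation satisfies mCor(X,Y)² = α (1 − kε/(k−1))². -/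
open MeasureTheory Real

/-- Integral of a function of a discrete variable, vanishing a.e. off a finite set of values. -/
lemma finite_law_integral {Ω β : Type*} [MeasurableSpace Ω] [MeasurableSpace β]
    [MeasurableSingletonClass β] [DecidableEq β] (μ : Measure Ω) [IsFiniteMeasure μ] (Z : Ω → β)
    (hZ : Measurable Z) (S : Finset β) (h : β → ℝ)
    (hS : ∀ᵐ ω ∂μ, Z ω ∉ S → h (Z ω) = 0) :
    Integrable (fun ω => h (Z ω)) μ ∧
      ∫ ω, h (Z ω) ∂μ = ∑ s ∈ S, μ.real {ω | Z ω = s} * h s := by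
  have hm : ∀ s, MeasurableSet {ω | Z ω = s} := fun s => hZ (measurableSet_singleton s)
  have hae : (fun ω => h (Z ω)) =ᵐ[μ]
      fun ω => ∑ s ∈ S, ({ω | Z ω = s}.indicator (fun _ => h s) ω) := by
    filter_upwards [hS] with ω hω
    simp only [Set.indicator_apply, Set.mem_setOf_eq]
    rw [Finset.sum_ite_eq]
    split_ifs with hc
    · rfl
    · exact hω hc
  have hint : ∀ s ∈ S, Integrable ({ω | Z ω = s}.indicator (fun _ => h s)) μ :=
    fun s _ => (integrable_const _).indicator (hm s)
  refine ⟨(integrable_finset_sum S hint).congr hae.symm, ?_⟩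
  rw [integral_congr_ae hae, integral_finset_sum S hint]
  refine Finset.sum_congr rfl fun s _ => ?_
  rw [integral_indicator_const _ (hm s), smul_eq_mul]

/-- **Maximal correlation under a rare symmetric-channel correlation (Example 3).**
If `X_r = {1,…,k}` has probability `α ∈ (0,1)`, `X` restricted to `X_r` is uniform, `Y` given
`X = x ∈ X_r` is the output of the symmetric channel with crossover `ε`, `Y` is independent of
`X` conditioned on `{X ∉ X_r}`, and the conditional law of `Y` given `{X ∉ X_r}` equals the
conditional law of `Y` given `{X ∈ X_r}` (the uniform distribution on `{1,…,k}`), then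
`mCor(X,Y)² = α (1 − kε/(k−1))²`. -/
theorem mCor_sq_rare_symmetric_channel {Ω : Type*} [MeasurableSpace Ω] (P : Measure Ω)
    [IsProbabilityMeasure P] (X Y : Ω → ℕ) (hX : Measurable X) (hY : Measurable Y)
    (k : ℕ) (hk : 2 ≤ k) (α : ℝ) (hα : α ∈ Set.Ioo (0 : ℝ) 1)
    (ε : ℝ) (hε : ε ∈ Set.Icc (0 : ℝ) (((k : ℝ) - 1) / k))
    (hXr : P {ω | 1 ≤ X ω ∧ X ω ≤ k} = ENNReal.ofReal α)
    (hunif : ∀ i, 1 ≤ i → i ≤ k → P {ω | X ω = i} = ENNReal.ofReal (α / k))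
    (hchan : ∀ i j, 1 ≤ i → i ≤ k → 1 ≤ j → j ≤ k →
      P {ω | X ω = i ∧ Y ω = j}
        = ENNReal.ofReal ((α / k) * (if j = i then 1 - ε else ε / ((k : ℝ) - 1))))
    (hindep : ProbabilityTheory.IndepFun X Y
      (ProbabilityTheory.cond P {ω | ¬(1 ≤ X ω ∧ X ω ≤ k)}))
    (hYunifIn : ∀ j, (ProbabilityTheory.cond P {ω | 1 ≤ X ω ∧ X ω ≤ k}) {ω | Y ω = j}
      = if 1 ≤ j ∧ j ≤ k then ENNReal.ofReal (1 / (k : ℝ)) else 0)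
    (hYunifOut : ∀ j, (ProbabilityTheory.cond P {ω | ¬(1 ≤ X ω ∧ X ω ≤ k)}) {ω | Y ω = j}
      = if 1 ≤ j ∧ j ≤ k then ENNReal.ofReal (1 / (k : ℝ)) else 0) :
    (mCorD P X Y) ^ 2 = α * (1 - (k : ℝ) * ε / ((k : ℝ) - 1)) ^ 2 := by
  obtain ⟨hα0, hα1⟩ := hα
  obtain ⟨hε0, hε1⟩ := hε
  have hk2 : (2 : ℝ) ≤ k := by exact_mod_cast hk
  have hk0 : (0 : ℝ) < k := by linarith
  have hk1 : (0 : ℝ) < (k : ℝ) - 1 := by linarith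
  set c : ℝ := 1 - (k : ℝ) * ε / ((k : ℝ) - 1) with hc
  have hc0 : 0 ≤ c := by
    rw [hc, sub_nonneg, div_le_one hk1]
    rw [le_div_iff₀ hk0] at hε1
    linarith
  set A : Set Ω := {ω | 1 ≤ X ω ∧ X ω ≤ k} with hA
  have hAc : {ω | ¬(1 ≤ X ω ∧ X ω ≤ k)} = Aᶜ := rfl
  rw [hAc] at hindep hYunifOut
  have hAm : MeasurableSet A := hX (measurableSet_Icc (a := 1) (b := k))
  set S : Finset ℕ := Finset.Icc 1 k with hS
  have hXp : ∀ i ∈ S, P.real {ω | X ω = i} = α / k := by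
    intro i hi
    rw [hS, Finset.mem_Icc] at hi
    rw [measureReal_def, hunif i hi.1 hi.2, ENNReal.toReal_ofReal (by positivity)]
  have hXYp : ∀ i ∈ S, ∀ j ∈ S, P.real {ω | (X ω, Y ω) = (i, j)}
      = (α / k) * (if j = i then 1 - ε else ε / ((k : ℝ) - 1)) := by
    intro i hi j hj
    rw [hS, Finset.mem_Icc] at hi hj
    have h1 : 0 ≤ 1 - ε := by
      have : ((k : ℝ) - 1) / k ≤ 1 := by rw [div_le_one hk0]; linarith
      linarith
    have : {ω | (X ω, Y ω) = (i, j)} = {ω | X ω = i ∧ Y ω = j} := by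
      ext ω; simp
    rw [this, measureReal_def, hchan i j hi.1 hi.2 hj.1 hj.2, ENNReal.toReal_ofReal]
    split_ifs <;> positivity
  have hYP : ∀ j, P {ω | Y ω = j} = if 1 ≤ j ∧ j ≤ k then ENNReal.ofReal (1 / (k : ℝ)) else 0 := by
    intro j
    rw [← ProbabilityTheory.cond_add_cond_compl_eq hAm P (t := {ω | Y ω = j}), hYunifIn, hYunifOut,
      ← mul_add, measure_add_measure_compl hAm, measure_univ, mul_one]
  -- law facts for Y under any finite measure with the uniform law
  have hlaw : ∀ μ : Measure Ω, (∀ j, μ {ω | Y ω = j}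
      = if 1 ≤ j ∧ j ≤ k then ENNReal.ofReal (1 / (k : ℝ)) else 0) → ∀ᵐ ω ∂μ, Y ω ∈ S := by
    intro μ hμ
    have : ∀ j, ∀ᵐ ω ∂μ, j ∉ S → Y ω ≠ j := by
      intro j
      by_cases hj : j ∈ S
      · simp [hj]
      · have h0 := hμ j
        rw [if_neg (by simpa [hS] using hj)] at h0
        have : ∀ᵐ ω ∂μ, Y ω ≠ j := by
          rw [ae_iff]; simpa using h0
        filter_upwards [this] with ω h _ using h
    filter_upwards [ae_all_iff.2 this] with ω hω
    by_contra hn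
    exact hω _ hn rfl
  have hYint : ∀ μ : Measure Ω, IsFiniteMeasure μ → (∀ j, μ {ω | Y ω = j}
      = if 1 ≤ j ∧ j ≤ k then ENNReal.ofReal (1 / (k : ℝ)) else 0) → ∀ g : ℕ → ℝ,
      Integrable (fun ω => g (Y ω)) μ ∧ ∫ ω, g (Y ω) ∂μ = (1 / k) * ∑ j ∈ S, g j := by
    intro μ _ hμ g
    have h := finite_law_integral μ Y hY S g (by
      filter_upwards [hlaw μ hμ] with ω h1 h2 using absurd h1 h2)
    refine ⟨h.1, ?_⟩
    rw [h.2, Finset.mul_sum]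
    refine Finset.sum_congr rfl fun j hj => ?_
    rw [measureReal_def, hμ j, if_pos (by simpa [hS] using hj),
      ENNReal.toReal_ofReal (by positivity)]
  have hPAc : P Aᶜ ≠ 0 := by
    rw [prob_compl_eq_one_sub hAm, hXr]
    simp [tsub_eq_zero_iff_le, hα1]
  have hcardS : (S.card : ℝ) = k := by simp [hS]
  -- the key formula
  have key : ∀ f g : ℕ → ℝ, Integrable (fun ω => (f (X ω)) ^ 2) P → ∑ j ∈ S, g j = 0 →
      ∫ ω, f (X ω) * g (Y ω) ∂P = (α / k) * c * ∑ i ∈ S, f i * g i := by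
    intro f g hf hg
    have hg2 := (hYint P inferInstance hYP (fun j => g j ^ 2)).1
    have hmf : Measurable fun ω => f (X ω) := (measurable_of_countable f).comp hX
    have hmg : Measurable fun ω => g (Y ω) := (measurable_of_countable g).comp hY
    have hint : Integrable (fun ω => f (X ω) * g (Y ω)) P := by
      refine (hf.add hg2).mono' (hmf.mul hmg).aestronglyMeasurable (ae_of_all _ fun ω => ?_)
      rw [Real.norm_eq_abs, Pi.add_apply, abs_le]
      constructor <;> nlinarith [sq_nonneg (f (X ω) + g (Y ω)), sq_nonneg (f (X ω) - g (Y ω)),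
        sq_nonneg (f (X ω)), sq_nonneg (g (Y ω))]
    have hout : ∫ ω in Aᶜ, f (X ω) * g (Y ω) ∂P = 0 := by
      have h1 : ∫ ω, f (X ω) * g (Y ω) ∂(ProbabilityTheory.cond P Aᶜ) = 0 := by
        have hi : ProbabilityTheory.IndepFun (fun ω => f (X ω)) (fun ω => g (Y ω))
            (ProbabilityTheory.cond P Aᶜ) :=
          hindep.comp (measurable_of_countable f) (measurable_of_countable g)
        have := hi.integral_fun_mul_eq_mul_integral hmf.aestronglyMeasurable
          hmg.aestronglyMeasurable
        rw [this, (hYint _ inferInstance hYunifOut g).2, hg]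
        simp
      rw [ProbabilityTheory.cond, integral_smul_measure, smul_eq_mul, mul_eq_zero] at h1
      rcases h1 with h1 | h1
      · exfalso
        rw [ENNReal.toReal_eq_zero_iff] at h1
        simp [hPAc] at h1
      · exact h1
    rw [← integral_add_compl hAm hint, hout, add_zero, ← integral_indicator hAm]
    have h2 := (finite_law_integral P (fun ω => (X ω, Y ω)) (hX.prodMk hY) (S ×ˢ S)
      (fun p => if p.1 ∈ S then f p.1 * g p.2 else 0) (by
        filter_upwards [hlaw P hYP] with ω h1 h2
        simp only [Finset.mem_product, h1, and_true] at h2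
        simp [h2])).2
    have h3 : (A.indicator fun ω => f (X ω) * g (Y ω))
        = fun ω => if X ω ∈ S then f (X ω) * g (Y ω) else 0 := by
      ext ω
      simp [Set.indicator_apply, hA, hS]
    rw [h3, h2, Finset.sum_product, Finset.mul_sum]
    refine Finset.sum_congr rfl fun i hi => ?_
    have h4 : ∀ j ∈ S, P.real {ω | (X ω, Y ω) = (i, j)} * (if i ∈ S then f i * g j else 0)
        = (α / k) * f i * (ε / ((k : ℝ) - 1)) * g j + (if j = i then (α / k) * f i * c * g j else 0) := by
      intro j hj
      rw [hXYp i hi j hj, if_pos hi, hc]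
      split_ifs
      · field_simp
        ring
      · ring
    rw [Finset.sum_congr rfl h4, Finset.sum_add_distrib, ← Finset.mul_sum, hg,
      Finset.sum_ite_eq', if_pos hi]
    ring
  have hsα : 0 < √α := Real.sqrt_pos.2 hα0
  have hsq : √α ^ 2 = α := Real.sq_sqrt hα0.le
  have hmain : IsGreatest { t | ∃ f g : ℕ → ℝ,
    Integrable (fun ω => f (X ω)) P ∧ Integrable (fun ω => g (Y ω)) P ∧
    Integrable (fun ω => (f (X ω)) ^ 2) P ∧ Integrable (fun ω => (g (Y ω)) ^ 2) P ∧
    (∫ ω, f (X ω) ∂P) = 0 ∧ (∫ ω, g (Y ω) ∂P) = 0 ∧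
    (∫ ω, (f (X ω)) ^ 2 ∂P) ≤ 1 ∧ (∫ ω, (g (Y ω)) ^ 2 ∂P) ≤ 1 ∧
    t = ∫ ω, f (X ω) * g (Y ω) ∂P } (√α * c) := by
    constructor
    · set r : ℝ := √((k : ℝ) / 2) with hr
      have hr2 : r ^ 2 = k / 2 := Real.sq_sqrt (by positivity)
      set g : ℕ → ℝ := fun j => (if j = 1 then r else 0) - (if j = 2 then r else 0) with hg
      have h1S : 1 ∈ S := by simp [hS]; omega
      have h2S : 2 ∈ S := by simp [hS]; omega
      have hgs : ∑ j ∈ S, g j = 0 := by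
        simp [hg, Finset.sum_sub_distrib, h1S, h2S]
      have hg2' : ∀ j, g j ^ 2 = (if j = 1 then r ^ 2 else 0) + (if j = 2 then r ^ 2 else 0) := by
        intro j
        simp only [hg]
        by_cases h1 : j = 1
        · simp [h1]
        · by_cases h2 : j = 2 <;> simp [h1, h2]
      have hg2 : ∑ j ∈ S, g j ^ 2 = k := by
        simp only [hg2']
        rw [Finset.sum_add_distrib]
        simp only [Finset.sum_ite_eq', h1S, h2S, if_true]
        linarith
      have hgout : ∀ j, j ∉ S → g j = 0 := by
        intro j hj
        have h1 : j ≠ 1 := fun h => hj (h ▸ h1S)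
        have h2 : j ≠ 2 := fun h => hj (h ▸ h2S)
        simp [hg, h1, h2]
      have hf1 := finite_law_integral P X hX S (fun i => g i / √α)
        (ae_of_all _ fun ω h => by simp [hgout _ h])
      have hf2 := finite_law_integral P X hX S (fun i => (g i / √α) ^ 2)
        (ae_of_all _ fun ω h => by simp [hgout _ h])
      have hY1 := hYint P inferInstance hYP g
      have hY2 := hYint P inferInstance hYP (fun j => g j ^ 2)
      refine ⟨fun i => g i / √α, g, hf1.1, hY1.1, hf2.1, hY2.1, ?_, ?_, ?_, ?_, ?_⟩
      · rw [hf1.2, Finset.sum_congr rfl fun i hi => by rw [hXp i hi], ← Finset.mul_sum,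
          ← Finset.sum_div, hgs]
        simp
      · rw [hY1.2, hgs, mul_zero]
      · rw [hf2.2, Finset.sum_congr rfl fun i hi => by rw [hXp i hi, div_pow, hsq],
          ← Finset.mul_sum, ← Finset.sum_div, hg2]
        apply le_of_eq
        field_simp
      · rw [hY2.2, hg2]
        apply le_of_eq
        field_simp
      · refine Eq.trans ?_ (key (fun i => g i / √α) g hf2.1 hgs).symm
        have : ∀ i ∈ S, g i / √α * g i = g i ^ 2 / √α := fun i _ => by ring
        rw [Finset.sum_congr rfl this, ← Finset.sum_div, hg2]
        field_simp
        rw [hsq, mul_comm]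
    · rintro t ⟨f, g, hf, hg, hf2, hg2, hf0, hg0, hf1, hg1, rfl⟩
      rw [(hYint P inferInstance hYP g).2] at hg0
      have hgs : ∑ j ∈ S, g j = 0 := by
        rcases mul_eq_zero.1 hg0 with h | h
        · exact absurd h (by positivity)
        · exact h
      rw [(hYint P inferInstance hYP (fun j => g j ^ 2)).2] at hg1
      rw [key f g hf2 hgs]
      have h1 := finite_law_integral P X hX S (fun i => if i ∈ S then f i ^ 2 else 0)
        (ae_of_all _ fun ω h => by simp [h])
      have h2 : ∫ ω, (if X ω ∈ S then f (X ω) ^ 2 else 0) ∂P ≤ ∫ ω, f (X ω) ^ 2 ∂P := by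
        refine integral_mono h1.1 hf2 fun ω => ?_
        dsimp only
        split_ifs
        · exact le_rfl
        · positivity
      have h3 : ∑ s ∈ S, P.real {ω | X ω = s} * (if s ∈ S then f s ^ 2 else 0)
          = (α / k) * ∑ i ∈ S, f i ^ 2 := by
        rw [Finset.mul_sum]
        refine Finset.sum_congr rfl fun i hi => ?_
        rw [hXp i hi, if_pos hi]
      have h4 : (α / k) * ∑ i ∈ S, f i ^ 2 ≤ 1 := by
        rw [← h3, ← h1.2]; exact h2.trans hf1
      -- AM-GM termwise
      have h5 : (α / k) * ∑ i ∈ S, f i * g i ≤ √α := by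
        have h6 : ∀ i ∈ S, 2 * √α * (f i * g i) ≤ α * f i ^ 2 + g i ^ 2 := by
          intro i _
          nlinarith [sq_nonneg (√α * f i - g i)]
        have h7 := Finset.sum_le_sum h6
        rw [← Finset.mul_sum, Finset.sum_add_distrib, ← Finset.mul_sum] at h7
        have h8 : 2 * √α * ∑ i ∈ S, f i * g i ≤ 2 * k := by
          have e1 : α * ∑ i ∈ S, f i ^ 2 ≤ k := by
            have := mul_le_mul_of_nonneg_left h4 hk0.le
            field_simp at this
            linarith
          have e2 : ∑ i ∈ S, g i ^ 2 ≤ k := by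
            have := mul_le_mul_of_nonneg_left hg1 hk0.le
            field_simp at this
            linarith
          linarith
        have h9 : √α * ∑ i ∈ S, f i * g i ≤ k := by linarith
        have h10 := mul_le_mul_of_nonneg_left h9 (by positivity : 0 ≤ √α / k)
        have e3 : √α / k * (√α * ∑ i ∈ S, f i * g i) = (α / k) * ∑ i ∈ S, f i * g i := by
          rw [← hsq]
          simp only [hsq]
          rw [← mul_assoc, div_mul_eq_mul_div, ← sq, hsq]
        rw [e3] at h10
        have e4 : √α / k * k = √α := by field_simp
        linarith
      calc α / k * c * ∑ i ∈ S, f i * g i = ((α / k) * ∑ i ∈ S, f i * g i) * c := by ring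
        _ ≤ √α * c := mul_le_mul_of_nonneg_right h5 hc0
  rw [mCorD, hmain.csSup_eq, mul_pow, hsq]
end

section
/- Let X and Y be finite sets and let p be a joint probability mass function on X × Y with full-support marginals p_X and p_Y. Let 0 < C1 < C2 and C0 > 0 be constants. For a pmf r on X, define r_Y(y) = Σ_x r(x) p(y|x) with p(y|x) = p(x,y)/p_X(x), and define s(r) = D(r_Y ‖ p_Y)/D(r ‖ p_X). Then for any two pmfs r and r' on X satisfying r(x)/p_X(x) ∈ [C1, C2] and r'(x)/p_X(x) ∈ [C1, C2] for all x ∈ X, and D(r ‖ p_X) > C0 and D(r' ‖ p_X) > C0, one has |s(r) − s(r')| ≤ L · max_{x ∈ X} |r(x) − r'(x)|, where L = 2|X| (max(|log C1|, |log C2|) + 1)/C0 and |X| is the cardinality of X. -/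
open Finset Real

/-- Kullback–Leibler divergence between two probability mass functions on a finite set,
with the convention `0 log 0 = 0`. -/
noncomputable def Dkl {X : Type*} [Fintype X] (q q' : X → ℝ) : ℝ :=
  ∑ x, q x * Real.log (q x / q' x)

theorem lip_aux (C1 C2 : ℝ) (hC1 : 0 < C1) (a b : ℝ) (ha : a ∈ Set.Icc C1 C2)
    (hb : b ∈ Set.Icc C1 C2) :
    |a * Real.log a - b * Real.log b| ≤ (max |Real.log C1| |Real.log C2| + 1) * |a - b| := by
  have h := Convex.norm_image_sub_le_of_norm_hasDerivWithin_le (𝕜 := ℝ)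
    (f := fun t : ℝ => t * Real.log t) (f' := fun t => Real.log t + 1) (s := Set.Icc C1 C2)
    (C := max |Real.log C1| |Real.log C2| + 1) (x := b) (y := a)
    (fun t ht => (Real.hasDerivAt_mul_log (lt_of_lt_of_le hC1 ht.1).ne').hasDerivWithinAt)
    ?_ (convex_Icc _ _) hb ha
  · simpa [Real.norm_eq_abs] using h
  · intro t ht
    have ht0 : 0 < t := lt_of_lt_of_le hC1 ht.1
    have h1 : Real.log C1 ≤ Real.log t := Real.log_le_log hC1 ht.1
    have h2 : Real.log t ≤ Real.log C2 := Real.log_le_log ht0 ht.2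
    have h3 : |Real.log t| ≤ max |Real.log C1| |Real.log C2| := abs_le_max_abs_abs h1 h2
    calc ‖Real.log t + 1‖ ≤ |Real.log t| + |(1:ℝ)| := abs_add_le _ _
      _ ≤ _ := by rw [abs_one]; linarith

theorem dkl_lip_aux {Z : Type*} [Fintype Z] (q a b : Z → ℝ) (hq : ∀ z, 0 < q z)
    (C1 C2 : ℝ) (hC1 : 0 < C1)
    (ha : ∀ z, a z / q z ∈ Set.Icc C1 C2) (hb : ∀ z, b z / q z ∈ Set.Icc C1 C2) :
    |Dkl a q - Dkl b q| ≤ (max |Real.log C1| |Real.log C2| + 1) * ∑ z, |a z - b z| := by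
  unfold Dkl
  rw [← Finset.sum_sub_distrib, Finset.mul_sum]
  refine (Finset.abs_sum_le_sum_abs _ _).trans (Finset.sum_le_sum fun z _ => ?_)
  have h := mul_le_mul_of_nonneg_left (lip_aux C1 C2 hC1 _ _ (ha z) (hb z)) (hq z).le
  have hne := (hq z).ne'
  have e1 : a z * Real.log (a z / q z) - b z * Real.log (b z / q z)
      = q z * (a z / q z * Real.log (a z / q z) - b z / q z * Real.log (b z / q z)) := by
    field_simp
  have e2 : |a z - b z| = q z * |a z / q z - b z / q z| := by
    rw [← sub_div, abs_div, abs_of_pos (hq z)]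
    field_simp
  rw [e1, abs_mul, abs_of_pos (hq z), e2]
  linarith

theorem dkl_nonneg_aux {Z : Type*} [Fintype Z] (q a : Z → ℝ) (hq : ∀ z, 0 < q z)
    (ha : ∀ z, 0 < a z) (hs : ∑ z, a z = ∑ z, q z) : 0 ≤ Dkl a q := by
  have : ∑ z, (a z - q z) ≤ Dkl a q := by
    refine Finset.sum_le_sum fun z _ => ?_
    have h := Real.one_sub_inv_le_log_of_pos (div_pos (ha z) (hq z))
    have h2 := mul_le_mul_of_nonneg_left h (ha z).le
    have e : a z * (1 - (a z / q z)⁻¹) = a z - q z := by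
      have := (ha z).ne'
      field_simp
    linarith
  rw [Finset.sum_sub_distrib, hs, sub_self] at this
  exact this

theorem ratio_aux {X Y : Type*} [Fintype X] (p : X × Y → ℝ) (hp0 : ∀ z, 0 ≤ p z)
    (pX : X → ℝ) (pY : Y → ℝ) (hpY : ∀ y, pY y = ∑ x, p (x, y))
    (hfullY : ∀ y, 0 < pY y) (C1 C2 : ℝ) (r : X → ℝ)
    (hr : ∀ x, r x / pX x ∈ Set.Icc C1 C2) (y : Y) :
    (∑ x, r x * (p (x, y) / pX x)) / pY y ∈ Set.Icc C1 C2 := by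
  have e : ∀ x, r x * (p (x, y) / pX x) = r x / pX x * p (x, y) := fun x => by ring
  simp only [e]
  constructor
  · rw [le_div_iff₀ (hfullY y), hpY, Finset.mul_sum]
    exact Finset.sum_le_sum fun x _ => mul_le_mul_of_nonneg_right (hr x).1 (hp0 _)
  · rw [div_le_iff₀ (hfullY y), hpY, Finset.mul_sum]
    exact Finset.sum_le_sum fun x _ => mul_le_mul_of_nonneg_right (hr x).2 (hp0 _)

theorem dpi_aux_s16 {X Y : Type*} [Fintype X] [Fintype Y] (p : X × Y → ℝ) (hp0 : ∀ z, 0 ≤ p z)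
    (pX : X → ℝ) (hpX : ∀ x, pX x = ∑ y, p (x, y))
    (pY : Y → ℝ) (hpY : ∀ y, pY y = ∑ x, p (x, y))
    (hfullX : ∀ x, 0 < pX x) (hfullY : ∀ y, 0 < pY y) (r : X → ℝ) (hr0 : ∀ x, 0 ≤ r x) :
    Dkl (fun y => ∑ x, r x * (p (x, y) / pX x)) pY ≤ Dkl r pX := by
  have key : ∀ y, (∑ x, r x * (p (x, y) / pX x)) *
      Real.log ((∑ x, r x * (p (x, y) / pX x)) / pY y)
      ≤ ∑ x, p (x, y) * (r x / pX x * Real.log (r x / pX x)) := by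
    intro y
    have hy := hfullY y
    have hne := hy.ne'
    have h := Real.convexOn_mul_log.map_sum_le (t := Finset.univ)
      (w := fun x => p (x, y) / pY y) (p := fun x => r x / pX x)
      (fun x _ => div_nonneg (hp0 _) hy.le)
      (by rw [← Finset.sum_div, ← hpY, div_self hne])
      (fun x _ => div_nonneg (hr0 x) (hfullX x).le)
    simp only [smul_eq_mul] at h
    have e : ∑ x, p (x, y) / pY y * (r x / pX x) = (∑ x, r x * (p (x, y) / pX x)) / pY y := by
      rw [Finset.sum_div]
      exact Finset.sum_congr rfl fun x _ => by ring
    rw [e] at h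
    have h2 := mul_le_mul_of_nonneg_left h hy.le
    rw [Finset.mul_sum] at h2
    calc _ = pY y * ((∑ x, r x * (p (x, y) / pX x)) / pY y *
          Real.log ((∑ x, r x * (p (x, y) / pX x)) / pY y)) := by
          rw [← mul_assoc, mul_div_cancel₀ _ hne]
      _ ≤ _ := h2
      _ = _ := Finset.sum_congr rfl fun x _ => by
          rw [← mul_assoc, mul_div_cancel₀ _ hne]
  unfold Dkl
  refine (Finset.sum_le_sum fun y _ => key y).trans (le_of_eq ?_)
  rw [Finset.sum_comm]
  refine Finset.sum_congr rfl fun x _ => ?_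
  have := (hfullX x).ne'
  rw [← Finset.sum_mul, ← hpX, ← mul_assoc, mul_div_cancel₀ _ this]

theorem sum_push_aux {X Y : Type*} [Fintype X] [Fintype Y] (p : X × Y → ℝ)
    (pX : X → ℝ) (hpX : ∀ x, pX x = ∑ y, p (x, y)) (hfullX : ∀ x, 0 < pX x) (r : X → ℝ) :
    ∑ y, ∑ x, r x * (p (x, y) / pX x) = ∑ x, r x := by
  rw [Finset.sum_comm]
  refine Finset.sum_congr rfl fun x _ => ?_
  rw [← Finset.mul_sum, ← Finset.sum_div, ← hpX, div_self (hfullX x).ne', mul_one]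

/-- **Lipschitz continuity of the hypercontractivity objective (Lemma 2).** For a joint pmf `p`
on a finite set `X × Y` with full-support marginals, and pmfs `r, r'` on `X` whose likelihood
ratios lie in `[C1, C2]` and whose divergences from `p_X` exceed `C0`,
`|s(r) − s(r')| ≤ L · max_x |r(x) − r'(x)|` with
`L = 2|X| (max(|log C1|, |log C2|) + 1)/C0`, where `s(r) = D(r_Y ‖ p_Y)/D(r ‖ p_X)`. -/
theorem hc_objective_lipschitz {X Y : Type*} [Fintype X] [Fintype Y] [Nonempty X] [Nonempty Y]
    (p : X × Y → ℝ) (hp0 : ∀ z, 0 ≤ p z) (hp1 : ∑ z, p z = 1)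
    (pX : X → ℝ) (hpX : ∀ x, pX x = ∑ y, p (x, y))
    (pY : Y → ℝ) (hpY : ∀ y, pY y = ∑ x, p (x, y))
    (hfullX : ∀ x, 0 < pX x) (hfullY : ∀ y, 0 < pY y)
    (C0 C1 C2 : ℝ) (hC1 : 0 < C1) (hC12 : C1 < C2) (hC0 : 0 < C0)
    (r r' : X → ℝ) (hr0 : ∀ x, 0 ≤ r x) (hr1 : ∑ x, r x = 1)
    (hr'0 : ∀ x, 0 ≤ r' x) (hr'1 : ∑ x, r' x = 1)
    (hrratio : ∀ x, r x / pX x ∈ Set.Icc C1 C2)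
    (hr'ratio : ∀ x, r' x / pX x ∈ Set.Icc C1 C2)
    (hrD : C0 < Dkl r pX) (hr'D : C0 < Dkl r' pX) :
    |Dkl (fun y => ∑ x, r x * (p (x, y) / pX x)) pY / Dkl r pX
        - Dkl (fun y => ∑ x, r' x * (p (x, y) / pX x)) pY / Dkl r' pX|
      ≤ (2 * (Fintype.card X : ℝ) * (max |Real.log C1| |Real.log C2| + 1) / C0)
          * (Finset.univ.sup' Finset.univ_nonempty fun x => |r x - r' x|) := by
  have hYr := ratio_aux p hp0 pX pY hpY hfullY C1 C2 r hrratio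
  have hYr' := ratio_aux p hp0 pX pY hpY hfullY C1 C2 r' hr'ratio
  have hD := dkl_lip_aux pX r r' hfullX C1 C2 hC1 hrratio hr'ratio
  have hN := dkl_lip_aux pY (fun y => ∑ x, r x * (p (x, y) / pX x))
    (fun y => ∑ x, r' x * (p (x, y) / pX x)) hfullY C1 C2 hC1 hYr hYr'
  have hdpi := dpi_aux_s16 p hp0 pX hpX pY hpY hfullX hfullY r' hr'0
  have hnn : 0 ≤ Dkl (fun y => ∑ x, r' x * (p (x, y) / pX x)) pY := by
    refine dkl_nonneg_aux _ _ hfullY (fun y => ?_) ?_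
    · have h := lt_of_lt_of_le hC1 (hYr' y).1
      have h2 := mul_pos h (hfullY y)
      rwa [div_mul_cancel₀ _ (hfullY y).ne'] at h2
    · rw [sum_push_aux p pX hpX hfullX, hr'1, ← hp1, Fintype.sum_prod_type_right]
      exact Finset.sum_congr rfl fun y _ => (hpY y).symm
  have hYsum : ∑ y, |(∑ x, r x * (p (x, y) / pX x)) - ∑ x, r' x * (p (x, y) / pX x)|
      ≤ ∑ x, |r x - r' x| := by
    rw [← sum_push_aux p pX hpX hfullX (fun x => |r x - r' x|)]
    refine Finset.sum_le_sum fun y _ => ?_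
    rw [← Finset.sum_sub_distrib]
    refine (Finset.abs_sum_le_sum_abs _ _).trans (le_of_eq ?_)
    refine Finset.sum_congr rfl fun x _ => ?_
    rw [← sub_mul, abs_mul, abs_of_nonneg (div_nonneg (hp0 _) (hfullX x).le)]
  have hm : ∑ x, |r x - r' x| ≤ (Fintype.card X : ℝ) *
      (Finset.univ.sup' Finset.univ_nonempty fun x => |r x - r' x|) := by
    have := Finset.sum_le_card_nsmul Finset.univ (fun x => |r x - r' x|)
      (Finset.univ.sup' Finset.univ_nonempty fun x => |r x - r' x|)
      (fun x hx => Finset.le_sup' (fun x => |r x - r' x|) hx)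
    simpa [nsmul_eq_mul] using this
  have hM : 0 ≤ max |Real.log C1| |Real.log C2| + 1 := by positivity
  have hN2 := hN.trans (mul_le_mul_of_nonneg_left (hYsum.trans hm) hM)
  have hD2 := hD.trans (mul_le_mul_of_nonneg_left hm hM)
  generalize (Finset.univ.sup' Finset.univ_nonempty fun x => |r x - r' x|) = m at *
  generalize Dkl (fun y => ∑ x, r x * (p (x, y) / pX x)) pY = N at *
  generalize Dkl (fun y => ∑ x, r' x * (p (x, y) / pX x)) pY = N' at *
  generalize Dkl r pX = D at *
  generalize Dkl r' pX = D' at *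
  generalize max |Real.log C1| |Real.log C2| + 1 = M at *
  have hDp : 0 < D := hC0.trans hrD
  have hD'p : 0 < D' := hC0.trans hr'D
  have e : N / D - N' / D' = ((N - N') - N' / D' * (D - D')) / D := by
    field_simp
    ring
  have hs : |N' / D'| ≤ 1 := by
    rw [abs_of_nonneg (div_nonneg hnn hD'p.le)]
    exact (div_le_one hD'p).2 hdpi
  have hB : |(N - N') - N' / D' * (D - D')| ≤ 2 * (M * ((Fintype.card X : ℝ) * m)) := by
    refine (abs_sub _ _).trans ?_
    rw [abs_mul]
    have := mul_le_mul_of_nonneg_right hs (abs_nonneg (D - D'))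
    linarith
  rw [e, abs_div, abs_of_pos hDp]
  calc _ ≤ |(N - N') - N' / D' * (D - D')| / C0 :=
        div_le_div_of_nonneg_left (abs_nonneg _) hC0 hrD.le
    _ ≤ 2 * (M * ((Fintype.card X : ℝ) * m)) / C0 := div_le_div_of_nonneg_right hB hC0.le
    _ = _ := by ring
end
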